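/- arXiv:math/0302223 — 11 statements merged into one kernel-verified Lean document; each statement's English description precedes it below -/
import Mathlib

section
/- Let R be an integral domain, let I be a nonzero proper strong ideal of R, and let x ∈ (R : I) \ I. Then (I :_R x) = {r ∈ R | r·x ∈ I} is a nonzero proper strong ideal of R containing I. -/
/-! Basic notions: for an integral domain `R` with fraction field `K`, an ideal `I`
is viewed as the submodule `idealToFrac R I` of `K`; `1 / M` is the Mathlib
submodule quotient `(R : M) = {x ∈ K | x M ⊆ R}` and `M / N = {x ∈ K | x N ⊆ M}`. -/

variable (R : Type*) [CommRing R] [IsDomain R]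

/-- The image of an ideal of `R` in the fraction field, as an `R`-submodule. -/
def idealToFrac (I : Ideal R) : Submodule R (FractionRing R) :=
  Submodule.map (Algebra.linearMap R (FractionRing R)) I

/-- An ideal `I` is strong if `(R : I) = (I : I)`. -/
def IsStrong (I : Ideal R) : Prop :=
  1 / idealToFrac R I = idealToFrac R I / idealToFrac R I

/-- An ideal `I` is divisorial if `(R : (R : I)) = I`. -/
def IsDivisorial (I : Ideal R) : Prop :=
  1 / (1 / idealToFrac R I) = idealToFrac R I

/-- `R` is seminormal if every `x ∈ K` with `x², x³ ∈ R` lies in `R`. -/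
def Seminormal : Prop :=
  ∀ x : FractionRing R,
    x ^ 2 ∈ (algebraMap R (FractionRing R)).range →
    x ^ 3 ∈ (algebraMap R (FractionRing R)).range →
    x ∈ (algebraMap R (FractionRing R)).range

/-- `R` is completely integrally closed if every almost integral element of `K` lies in `R`. -/
def CompletelyIntegrallyClosed : Prop :=
  ∀ x : FractionRing R,
    (∃ d : R, d ≠ 0 ∧
      ∀ n : ℕ, algebraMap R (FractionRing R) d * x ^ n ∈ (algebraMap R (FractionRing R)).range) →
    x ∈ (algebraMap R (FractionRing R)).range

/-- The `v`-operation `M ↦ (R : (R : M))` on submodules of the fraction field. -/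
def vOp (M : Submodule R (FractionRing R)) : Submodule R (FractionRing R) :=
  1 / (1 / M)

/-- The `t`-closure `M_t = ⋃ J_v`, the union over finitely generated `J ⊆ M`. -/
def tClosure (M : Submodule R (FractionRing R)) : Submodule R (FractionRing R) :=
  ⨆ (J : Submodule R (FractionRing R)) (_ : J.FG) (_ : J ≤ M), vOp R J

/-- An ideal `I` is a `t`-ideal if `I_t = I`. -/
def IsTIdeal (I : Ideal R) : Prop :=
  tClosure R (idealToFrac R I) = idealToFrac R I

/-- A maximal `t`-ideal is an ideal maximal among the proper integral `t`-ideals. -/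
def IsMaximalTIdeal (I : Ideal R) : Prop :=
  I ≠ ⊤ ∧ IsTIdeal R I ∧ ∀ J : Ideal R, J ≠ ⊤ → IsTIdeal R J → I ≤ J → J = I

/-- An ideal `I` is `t`-invertible if `(I (R : I))_t = R`. -/
def IsTInvertible (I : Ideal R) : Prop :=
  tClosure R (idealToFrac R I * (1 / idealToFrac R I)) = 1

/-- An ideal `I` is invertible if `I (R : I) = R`. -/
def IsInvertibleIdeal (I : Ideal R) : Prop :=
  idealToFrac R I * (1 / idealToFrac R I) = 1

/-- Let `R` be an integral domain, `I` a nonzero proper strong ideal of `R`, and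
`x ∈ (R : I) \ I`. Then `(I :_R x) = {r ∈ R | r x ∈ I}` is a nonzero proper strong
ideal of `R` containing `I`. -/
theorem colon_of_strong_isStrong {R : Type*} [CommRing R] [IsDomain R]
    (I : Ideal R) (hne : I ≠ ⊥) (hproper : I ≠ ⊤) (hstrong : IsStrong R I)
    (x : FractionRing R) (hx1 : x ∈ 1 / idealToFrac R I) (hx2 : x ∉ idealToFrac R I)
    (J : Ideal R)
    (hJ : ∀ r : R, r ∈ J ↔ algebraMap R (FractionRing R) r * x ∈ idealToFrac R I) :
    J ≠ ⊥ ∧ J ≠ ⊤ ∧ I ≤ J ∧ IsStrong R J := by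
  unfold IsStrong at hstrong ⊢
  have memI : ∀ (A : Ideal R) (r : R), r ∈ A →
      algebraMap R (FractionRing R) r ∈ idealToFrac R A :=
    fun A r hr => ⟨r, hr, rfl⟩
  have hle : I ≤ J := by
    intro r hr
    rw [hJ, mul_comm]
    rw [hstrong, Submodule.mem_div_iff_forall_mul_mem] at hx1
    exact hx1 _ (memI I r hr)
  refine ⟨fun h => hne (le_bot_iff.mp (h ▸ hle)), ?_, hle, ?_⟩
  · intro h
    apply hx2
    have h1 := (hJ 1).mp (h ▸ Submodule.mem_top)
    simpa using h1
  · ext y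
    rw [Submodule.mem_div_iff_forall_mul_mem, Submodule.mem_div_iff_forall_mul_mem]
    constructor
    · intro hy
      have hyI : y ∈ 1 / idealToFrac R I := by
        rw [Submodule.mem_div_iff_forall_mul_mem]
        rintro _ ⟨r, hr, rfl⟩
        exact hy _ (memI J r (hle hr))
      rw [hstrong, Submodule.mem_div_iff_forall_mul_mem] at hyI
      rintro _ ⟨r, hr, rfl⟩
      have h1 := hy _ (memI J r hr)
      obtain ⟨s, hs⟩ := Submodule.mem_one.mp h1
      refine ⟨s, ?_, hs⟩
      refine (hJ s).mpr ?_
      rw [hs, mul_assoc]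
      exact hyI _ ((hJ r).mp hr)
    · intro hy z hz
      obtain ⟨s, _, hs⟩ := hy z hz
      exact Submodule.mem_one.mpr ⟨s, hs⟩
end

section
/- Let R be an integral domain and let I be an ideal that is maximal (with respect to inclusion) in the set of nonzero proper strongly divisorial ideals of R. Then I is a prime ideal of R. -/
/-! Basic notions: for an integral domain `R` with fraction field `K`, an ideal `I`
is viewed as the submodule `idealToFrac R I` of `K`; `1 / M` is the Mathlib
submodule quotient `(R : M) = {x ∈ K | x M ⊆ R}` and `M / N = {x ∈ K | x N ⊆ M}`. -/

variable (R : Type*) [CommRing R] [IsDomain R]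

theorem aux_mem_frac {R : Type*} [CommRing R] [IsDomain R] (I : Ideal R) (z : FractionRing R) :
    z ∈ idealToFrac R I ↔ ∃ x ∈ I, algebraMap R (FractionRing R) x = z := by
  simp [idealToFrac, Submodule.mem_map]

theorem aux_mem_inv {R : Type*} [CommRing R] [IsDomain R] (I : Ideal R) (z : FractionRing R) :
    z ∈ 1 / idealToFrac R I ↔ ∀ x ∈ I, ∃ r : R, algebraMap R (FractionRing R) r =
      z * algebraMap R (FractionRing R) x := by
  rw [Submodule.mem_div_iff_forall_mul_mem]
  simp only [aux_mem_frac, Submodule.mem_one]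
  constructor
  · intro h x hx
    exact h _ ⟨x, hx, rfl⟩
  · rintro h _ ⟨x, hx, rfl⟩
    exact h x hx

/-- An ideal maximal (w.r.t. inclusion) in the set of nonzero proper strongly
divisorial ideals of an integral domain is prime. -/
theorem maximal_strongly_divisorial_isPrime {R : Type*} [CommRing R] [IsDomain R]
    (I : Ideal R) (hne : I ≠ ⊥) (hproper : I ≠ ⊤)
    (hstrong : IsStrong R I) (hdiv : IsDivisorial R I)
    (hmax : ∀ J : Ideal R, J ≠ ⊥ → J ≠ ⊤ → IsStrong R J → IsDivisorial R J →
      I ≤ J → J = I) :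
    I.IsPrime := by
  have inj := IsFractionRing.injective R (FractionRing R)
  refine ⟨hproper, ?_⟩
  intro a b hab
  by_contra! hcon
  obtain ⟨ha, hb⟩ := hcon
  let J : Ideal R := Submodule.comap (LinearMap.mulLeft R a) I
  have hJ : ∀ x, x ∈ J ↔ a * x ∈ I := fun x => Iff.rfl
  have hIJ : I ≤ J := fun x hx => (hJ x).2 (I.mul_mem_left a hx)
  have key : J = I := by
    refine hmax J ?_ ?_ ?_ ?_ hIJ
    · intro h
      exact hne (le_bot_iff.1 (h ▸ hIJ))
    · intro h
      apply ha
      have : (1 : R) ∈ J := h ▸ Submodule.mem_top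
      simpa using (hJ 1).1 this
    · apply le_antisymm
      · intro y hy
        rw [aux_mem_inv] at hy
        have hyI : y ∈ 1 / idealToFrac R I := (aux_mem_inv I y).2 fun x hx => hy x (hIJ hx)
        rw [hstrong, Submodule.mem_div_iff_forall_mul_mem] at hyI
        rw [Submodule.mem_div_iff_forall_mul_mem]
        intro z hz
        obtain ⟨x, hx, rfl⟩ := (aux_mem_frac J z).1 hz
        obtain ⟨r, hr⟩ := hy x hx
        rw [aux_mem_frac]
        refine ⟨r, ?_, hr⟩
        obtain ⟨s, hs, hs'⟩ := (aux_mem_frac I _).1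
          (hyI _ ((aux_mem_frac I _).2 ⟨a * x, (hJ x).1 hx, rfl⟩))
        have : a * r = s := by
          apply inj
          rw [hs', map_mul, map_mul, hr]
          ring
        rw [hJ, this]
        exact hs
      · intro y hy
        rw [Submodule.mem_div_iff_forall_mul_mem] at hy
        rw [aux_mem_inv]
        intro x hx
        obtain ⟨r, _, hr⟩ := (aux_mem_frac J _).1 (hy _ ((aux_mem_frac J _).2 ⟨x, hx, rfl⟩))
        exact ⟨r, hr⟩
    · apply le_antisymm
      · intro z hz
        rw [Submodule.mem_div_iff_forall_mul_mem] at hz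
        have h1 : (1 : FractionRing R) ∈ 1 / idealToFrac R J :=
          (aux_mem_inv J 1).2 fun x _ => ⟨x, by simp⟩
        obtain ⟨r, hr⟩ := Submodule.mem_one.1 (hz 1 h1)
        rw [mul_one] at hr
        rw [aux_mem_frac]
        refine ⟨r, ?_, hr⟩
        rw [hJ]
        have hm : algebraMap R (FractionRing R) (a * r) ∈ 1 / (1 / idealToFrac R I) := by
          rw [Submodule.mem_div_iff_forall_mul_mem]
          intro y hy
          have hay : algebraMap R (FractionRing R) a * y ∈ 1 / idealToFrac R J := by
            rw [aux_mem_inv] at hy ⊢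
            intro x hx
            obtain ⟨s, hs⟩ := hy _ ((hJ x).1 hx)
            refine ⟨s, ?_⟩
            rw [hs, map_mul]
            ring
          have := hz _ hay
          rw [← hr] at this
          convert this using 1
          rw [map_mul]
          ring
        rw [hdiv, aux_mem_frac] at hm
        obtain ⟨s, hs, hs'⟩ := hm
        rw [← inj hs']
        exact hs
      · intro z hz
        rw [Submodule.mem_div_iff_forall_mul_mem]
        intro y hy
        rw [Submodule.mem_div_iff_forall_mul_mem] at hy
        rw [mul_comm]
        exact hy z hz
  exact hb (key ▸ (hJ b).2 hab)
end

section
/- Let R be an integral domain and let I be a nonzero divisorial ideal of R such that (√I)ⁿ ⊆ I for some integer n ≥ 1, where √I is the radical of I. Then √I is a divisorial ideal of R. -/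
/-! Basic notions: for an integral domain `R` with fraction field `K`, an ideal `I`
is viewed as the submodule `idealToFrac R I` of `K`; `1 / M` is the Mathlib
submodule quotient `(R : M) = {x ∈ K | x M ⊆ R}` and `M / N = {x ∈ K | x N ⊆ M}`. -/

variable (R : Type*) [CommRing R] [IsDomain R]

theorem vOp_mul_mem {R : Type*} [CommRing R] [IsDomain R]
    (A B : Submodule R (FractionRing R)) {x y : FractionRing R}
    (hx : x ∈ 1 / (1 / A)) (hy : y ∈ 1 / (1 / B)) : x * y ∈ 1 / (1 / (A * B)) := by
  rw [Submodule.mem_div_iff_forall_mul_mem] at *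
  intro z hz
  rw [Submodule.mem_div_iff_forall_mul_mem] at hz
  rw [mul_assoc]
  apply hx
  rw [Submodule.mem_div_iff_forall_mul_mem]
  intro a ha
  rw [mul_assoc]
  apply hy
  rw [Submodule.mem_div_iff_forall_mul_mem]
  intro b hb
  rw [mul_assoc]
  exact hz _ (Submodule.mul_mem_mul ha hb)

theorem le_vOp_aux {R : Type*} [CommRing R] [IsDomain R]
    (A : Submodule R (FractionRing R)) : A ≤ 1 / (1 / A) := by
  intro x hx
  rw [Submodule.mem_div_iff_forall_mul_mem]
  intro z hz
  rw [mul_comm]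
  exact (Submodule.mem_div_iff_forall_mul_mem.1 hz) x hx

theorem vOp_mono_aux {R : Type*} [CommRing R] [IsDomain R]
    {A B : Submodule R (FractionRing R)} (h : A ≤ B) : 1 / (1 / A) ≤ 1 / (1 / B) := by
  intro x hx
  rw [Submodule.mem_div_iff_forall_mul_mem] at *
  intro z hz
  apply hx
  rw [Submodule.mem_div_iff_forall_mul_mem] at *
  exact fun a ha => hz a (h ha)

theorem vOp_pow_mem {R : Type*} [CommRing R] [IsDomain R]
    (J : Ideal R) {x : FractionRing R}
    (hx : x ∈ 1 / (1 / idealToFrac R J)) (n : ℕ) :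
    x ^ n ∈ 1 / (1 / idealToFrac R (J ^ n)) := by
  induction n with
  | zero =>
    apply le_vOp_aux
    exact ⟨1, by simp, by simp⟩
  | succ k ih =>
    rw [pow_succ]
    refine vOp_mono_aux ?_ (vOp_mul_mem _ _ ih hx)
    rw [Submodule.mul_le]
    rintro _ ⟨a, ha, rfl⟩ _ ⟨b, hb, rfl⟩
    exact ⟨a * b, Ideal.mul_mem_mul ha hb, by simp⟩

/-- If a nonzero divisorial ideal `I` of a domain `R` contains a power of its radical,
then `√I` is divisorial. -/
theorem radical_isDivisorial_of_pow_radical_le {R : Type*} [CommRing R] [IsDomain R]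
    (I : Ideal R) (hne : I ≠ ⊥) (hdiv : IsDivisorial R I)
    (n : ℕ) (hn : 1 ≤ n) (hrad : I.radical ^ n ≤ I) :
    IsDivisorial R I.radical := by
  apply le_antisymm _ (le_vOp_aux _)
  intro x hx
  have hx1 : x ∈ (1 : Submodule R (FractionRing R)) := by
    have h := Submodule.mem_div_iff_forall_mul_mem.1 hx 1 (by
      rw [Submodule.mem_div_iff_forall_mul_mem]
      rintro _ ⟨a, ha, rfl⟩
      rw [one_mul]
      exact Submodule.mem_one.2 ⟨a, rfl⟩)
    simpa using h
  obtain ⟨r, rfl⟩ := Submodule.mem_one.1 hx1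
  have h := vOp_mono_aux (Submodule.map_mono hrad) (vOp_pow_mem _ hx n)
  change _ ∈ 1 / (1 / idealToFrac R I) at h
  rw [hdiv] at h
  obtain ⟨s, hs, hsr⟩ := h
  rw [← map_pow] at hsr
  have : s = r ^ n := IsFractionRing.injective R (FractionRing R) hsr
  subst this
  exact ⟨r, ⟨n, hs⟩, rfl⟩
end

section
/- Let R be an integral domain, let {P_λ}_{λ∈Λ} be a family of prime ideals of R, and suppose that I = ⋂_{λ∈Λ} P_λ is a nonzero divisorial ideal of R. If μ ∈ Λ is such that ⋂_{λ≠μ} P_λ is not contained in P_μ (i.e., P_μ cannot be omitted from the intersection), then P_μ is a divisorial ideal of R. -/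
/-! Basic notions: for an integral domain `R` with fraction field `K`, an ideal `I`
is viewed as the submodule `idealToFrac R I` of `K`; `1 / M` is the Mathlib
submodule quotient `(R : M) = {x ∈ K | x M ⊆ R}` and `M / N = {x ∈ K | x N ⊆ M}`. -/

variable (R : Type*) [CommRing R] [IsDomain R]

/-- If a nonzero divisorial ideal `I` of a domain `R` is an intersection of primes
`I = ⋂ P_λ` and the prime `P_μ` is essential for this representation (i.e. it cannot
be omitted), then `P_μ` is divisorial. -/
theorem essential_prime_isDivisorial {R : Type*} [CommRing R] [IsDomain R]
    {Λ : Type*} (P : Λ → Ideal R) (hP : ∀ l, (P l).IsPrime)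
    (hne : (⨅ l, P l) ≠ ⊥) (hdiv : IsDivisorial R (⨅ l, P l))
    (μ : Λ) (hess : ¬ (⨅ (l) (_ : l ≠ μ), P l) ≤ P μ) :
    IsDivisorial R (P μ) := by
  obtain ⟨a, ha, haP⟩ := Set.not_subset.mp hess
  have haI : ∀ p ∈ P μ, a * p ∈ ⨅ l, P l := by
    intro p hp
    rw [Ideal.mem_iInf]
    intro l
    by_cases hl : l = μ
    · subst hl
      exact Ideal.mul_mem_left _ _ hp
    · have h1 : a ∈ P l := (iInf₂_le (f := fun (l : Λ) (_ : l ≠ μ) => P l) l hl) ha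
      exact Ideal.mul_mem_right _ _ h1
  unfold IsDivisorial at hdiv ⊢
  apply le_antisymm
  · intro x hx
    rw [Submodule.mem_div_iff_forall_mul_mem] at hx
    have h1 : (1 : FractionRing R) ∈ 1 / idealToFrac R (P μ) := by
      rw [Submodule.mem_div_iff_forall_mul_mem]
      rintro _ ⟨p, _, rfl⟩
      rw [one_mul]
      exact Submodule.mem_one.mpr ⟨p, rfl⟩
    have h2 := hx 1 h1
    rw [mul_one] at h2
    obtain ⟨r, rfl⟩ := Submodule.mem_one.mp h2
    have h3 : algebraMap R (FractionRing R) (a * r) ∈ idealToFrac R (⨅ l, P l) := by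
      rw [← hdiv, Submodule.mem_div_iff_forall_mul_mem]
      intro y hy
      rw [Submodule.mem_div_iff_forall_mul_mem] at hy
      have h4 : algebraMap R (FractionRing R) a * y ∈ 1 / idealToFrac R (P μ) := by
        rw [Submodule.mem_div_iff_forall_mul_mem]
        rintro _ ⟨p, hp, rfl⟩
        have h5 := hy (algebraMap R (FractionRing R) (a * p)) ⟨a * p, haI p hp, rfl⟩
        rw [map_mul] at h5
        rw [Algebra.linearMap_apply]
        convert h5 using 1
        ring
      have h6 := hx _ h4
      rw [map_mul]
      convert h6 using 1
      ring
    obtain ⟨q, hq, hqe⟩ := h3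
    have hqe' : q = a * r := IsFractionRing.injective R (FractionRing R) hqe
    subst hqe'
    have h7 : a * r ∈ P μ := (iInf_le P μ) hq
    exact ⟨r, ((hP μ).mem_or_mem h7).resolve_left haP, rfl⟩
  · intro x hx
    rw [Submodule.mem_div_iff_forall_mul_mem]
    intro y hy
    rw [Submodule.mem_div_iff_forall_mul_mem] at hy
    rw [mul_comm]
    exact hy x hx
end

section
/- Let R be an integral domain, let {P_λ}_{λ∈Λ} be a family of prime ideals of R, and suppose that I = ⋂_{λ∈Λ} P_λ is nonzero and the intersection is irredundant. Then: (a) I is a strong ideal of R if and only if P_λ is a strong ideal of R for every λ ∈ Λ; (b) I is a divisorial ideal of R if and only if P_λ is a divisorial ideal of R for every λ ∈ Λ. -/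
/-! Basic notions: for an integral domain `R` with fraction field `K`, an ideal `I`
is viewed as the submodule `idealToFrac R I` of `K`; `1 / M` is the Mathlib
submodule quotient `(R : M) = {x ∈ K | x M ⊆ R}` and `M / N = {x ∈ K | x N ⊆ M}`. -/

variable (R : Type*) [CommRing R] [IsDomain R]

theorem isStrong_iff_aux {R : Type*} [CommRing R] [IsDomain R] (I : Ideal R) :
    IsStrong R I ↔ ∀ x : FractionRing R,
      (∀ i ∈ I, ∃ s : R, algebraMap R (FractionRing R) s = x * algebraMap R _ i) →
      ∀ i ∈ I, ∃ s ∈ I, algebraMap R (FractionRing R) s = x * algebraMap R _ i := by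
  have h1 : ∀ x : FractionRing R, x ∈ 1 / idealToFrac R I ↔
      ∀ i ∈ I, ∃ s : R, algebraMap R (FractionRing R) s = x * algebraMap R _ i := by
    intro x
    simp [Submodule.mem_div_iff_forall_mul_mem, idealToFrac, Submodule.mem_one]
  have h2 : ∀ x : FractionRing R, x ∈ idealToFrac R I / idealToFrac R I ↔
      ∀ i ∈ I, ∃ s ∈ I, algebraMap R (FractionRing R) s = x * algebraMap R _ i := by
    intro x
    simp [Submodule.mem_div_iff_forall_mul_mem, idealToFrac]
  unfold IsStrong
  constructor
  · intro h x hx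
    exact (h2 x).1 (h ▸ (h1 x).2 hx)
  · intro h
    ext x
    rw [h1, h2]
    refine ⟨h x, fun hx i hi => ?_⟩
    obtain ⟨s, _, hs⟩ := hx i hi
    exact ⟨s, hs⟩

theorem isDivisorial_iff_aux {R : Type*} [CommRing R] [IsDomain R] (I : Ideal R) :
    IsDivisorial R I ↔ ∀ r : R, (∀ x : FractionRing R,
      (∀ i ∈ I, ∃ s : R, algebraMap R (FractionRing R) s = x * algebraMap R _ i) →
      ∃ s : R, algebraMap R (FractionRing R) s = x * algebraMap R _ r) → r ∈ I := by
  have h1 : ∀ x : FractionRing R, x ∈ 1 / idealToFrac R I ↔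
      ∀ i ∈ I, ∃ s : R, algebraMap R (FractionRing R) s = x * algebraMap R _ i := by
    intro x
    simp [Submodule.mem_div_iff_forall_mul_mem, idealToFrac, Submodule.mem_one]
  have h3 : ∀ y : FractionRing R, y ∈ 1 / (1 / idealToFrac R I) ↔ ∀ x : FractionRing R,
      (∀ i ∈ I, ∃ s : R, algebraMap R (FractionRing R) s = x * algebraMap R _ i) →
      ∃ s : R, algebraMap R (FractionRing R) s = x * y := by
    intro y
    rw [Submodule.mem_div_iff_forall_mul_mem]
    simp only [h1, Submodule.mem_one, mul_comm y]
  have h2 : ∀ y : FractionRing R, y ∈ idealToFrac R I ↔ 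
      ∃ s ∈ I, algebraMap R (FractionRing R) s = y := by
    intro x
    simp [idealToFrac]
  unfold IsDivisorial
  constructor
  · intro h r hr
    obtain ⟨s, hs, e⟩ := (h2 _).1 (h ▸ (h3 _).2 hr)
    rwa [← IsFractionRing.injective R (FractionRing R) e]
  · intro h
    ext y
    rw [h2, h3]
    constructor
    · intro hy
      obtain ⟨s, hs⟩ := hy 1 (fun i _ => ⟨i, by simp⟩)
      rw [one_mul] at hs
      subst hs
      exact ⟨s, h s hy, rfl⟩
    · rintro ⟨s, hs, rfl⟩ x hx
      exact hx s hs

/-- Let `{P_λ}` be a family of prime ideals of a domain `R` whose intersection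
`I = ⋂ P_λ` is nonzero and irredundant. Then `I` is strong iff every `P_λ` is strong,
and `I` is divisorial iff every `P_λ` is divisorial. -/
theorem irredundant_intersection_strong_divisorial_iff {R : Type*} [CommRing R] [IsDomain R]
    {Λ : Type*} (P : Λ → Ideal R) (hP : ∀ l, (P l).IsPrime)
    (hne : (⨅ l, P l) ≠ ⊥)
    (hirr : ∀ μ : Λ, ¬ (⨅ (l) (_ : l ≠ μ), P l) ≤ P μ) :
    (IsStrong R (⨅ l, P l) ↔ ∀ l, IsStrong R (P l)) ∧
    (IsDivisorial R (⨅ l, P l) ↔ ∀ l, IsDivisorial R (P l)) := by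
  have key : ∀ μ, ∃ a, a ∉ P μ ∧ ∀ p ∈ P μ, a * p ∈ ⨅ l, P l := by
    intro μ
    obtain ⟨a, ha, hn⟩ := Set.not_subset.1 (hirr μ)
    refine ⟨a, hn, fun p hp => ?_⟩
    rw [Ideal.mem_iInf]
    intro l
    by_cases hl : l = μ
    · subst hl; exact Ideal.mul_mem_left _ _ hp
    · have ha' : a ∈ (⨅ (l) (_ : l ≠ μ), P l) := ha
      simp only [Ideal.mem_iInf] at ha'
      exact Ideal.mul_mem_right _ _ (ha' l hl)
  have hle : ∀ μ, ∀ i ∈ ⨅ l, P l, i ∈ P μ := fun μ i hi => Ideal.mem_iInf.1 hi μ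
  have inj := IsFractionRing.injective R (FractionRing R)
  simp only [isStrong_iff_aux, isDivisorial_iff_aux]
  refine ⟨⟨?_, ?_⟩, ⟨?_, ?_⟩⟩
  · intro h μ x hx p hp
    obtain ⟨a, ha, hap⟩ := key μ
    obtain ⟨s, hs, e⟩ := h x (fun i hi => hx i (hle μ i hi)) _ (hap p hp)
    obtain ⟨t, ht⟩ := hx p hp
    have e2 : s = a * t := inj (by rw [e, map_mul, map_mul, ht]; ring)
    exact ⟨t, ((hP μ).mem_or_mem (e2 ▸ hle μ s hs)).resolve_left ha, ht⟩
  · intro h x hx i hi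
    obtain ⟨t, ht⟩ := hx i hi
    refine ⟨t, Ideal.mem_iInf.2 fun μ => ?_, ht⟩
    obtain ⟨a, ha, hap⟩ := key μ
    obtain ⟨s, hs, e⟩ := h μ (x * algebraMap R _ a) (fun p hp => by
      obtain ⟨u, hu⟩ := hx _ (hap p hp)
      exact ⟨u, by rw [hu, map_mul]; ring⟩) i (hle μ i hi)
    have e2 : s = a * t := inj (by rw [e, map_mul, ht]; ring)
    exact ((hP μ).mem_or_mem (e2 ▸ hs)).resolve_left ha
  · intro h μ r hr
    obtain ⟨a, ha, hap⟩ := key μ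
    refine ((hP μ).mem_or_mem (hle μ _ (h (a * r) fun y hy => ?_))).resolve_left ha
    obtain ⟨s, e⟩ := hr (y * algebraMap R _ a) (fun p hp => by
      obtain ⟨u, hu⟩ := hy _ (hap p hp)
      exact ⟨u, by rw [hu, map_mul]; ring⟩)
    exact ⟨s, by rw [e, map_mul]; ring⟩
  · intro h r hr
    exact Ideal.mem_iInf.2 fun μ => h μ r fun x hx => hr x fun i hi => hx i (hle μ i hi)
end

section
/- Let R be an integral domain having a nonzero proper strongly divisorial ideal I such that (√I)ⁿ ⊆ I for some integer n ≥ 1 and such that √I = ⋂_{λ∈Λ} P_λ is an irredundant intersection of prime ideals of R. Then every prime P_λ in this intersection is strongly divisorial; in particular, if the P_λ are the minimal primes over I, then all the minimal primes over I are strongly divisorial. -/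
/-! Basic notions: for an integral domain `R` with fraction field `K`, an ideal `I`
is viewed as the submodule `idealToFrac R I` of `K`; `1 / M` is the Mathlib
submodule quotient `(R : M) = {x ∈ K | x M ⊆ R}` and `M / N = {x ∈ K | x N ⊆ M}`. -/

variable (R : Type*) [CommRing R] [IsDomain R]

theorem sd_mem_idealToFrac {R : Type*} [CommRing R] [IsDomain R] (I : Ideal R)
    (x : FractionRing R) :
    x ∈ idealToFrac R I ↔ ∃ r ∈ I, algebraMap R (FractionRing R) r = x := by
  simp [idealToFrac, Submodule.mem_map]

theorem sd_coe_mem {R : Type*} [CommRing R] [IsDomain R] (I : Ideal R) (r : R) :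
    algebraMap R (FractionRing R) r ∈ idealToFrac R I ↔ r ∈ I := by
  rw [sd_mem_idealToFrac]
  constructor
  · rintro ⟨q, hq, h⟩
    rwa [← IsFractionRing.injective R (FractionRing R) h]
  · intro h
    exact ⟨r, h, rfl⟩

/-- A residual `(I :_R S)` containing `I`, of a strongly divisorial ideal is strongly divisorial. -/
theorem sd_residual {R : Type*} [CommRing R] [IsDomain R] (I P : Ideal R) (S : Set R)
    (hstrong : IsStrong R I) (hdiv : IsDivisorial R I) (hIP : I ≤ P)
    (h : ∀ r, r ∈ P ↔ ∀ y ∈ S, r * y ∈ I) : IsStrong R P ∧ IsDivisorial R P := by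
  have key : ∀ x : FractionRing R, x ∈ 1 / idealToFrac R P → x ∈ 1 / idealToFrac R I := by
    intro x hx
    rw [Submodule.mem_div_iff_forall_mul_mem] at hx ⊢
    exact fun y hy => hx y (Submodule.map_mono hIP hy)
  constructor
  · apply le_antisymm
    · intro x hx
      have hxI := key x hx
      rw [show 1 / idealToFrac R I = _ from hstrong] at hxI
      rw [Submodule.mem_div_iff_forall_mul_mem] at hx hxI ⊢
      intro p hp
      obtain ⟨q, hq⟩ := Submodule.mem_one.1 (hx p hp)
      obtain ⟨r, hr, rfl⟩ := (sd_mem_idealToFrac P p).1 hp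
      rw [← hq, sd_coe_mem, h]
      intro y hy
      have h1 := hxI _ ((sd_coe_mem I _).2 ((h r).1 hr y hy))
      rw [map_mul, ← mul_assoc, ← hq, ← map_mul, sd_coe_mem] at h1
      exact h1
    · intro x hx
      rw [Submodule.mem_div_iff_forall_mul_mem] at hx ⊢
      intro p hp
      obtain ⟨r, hr, h1⟩ := (sd_mem_idealToFrac P _).1 (hx p hp)
      exact Submodule.mem_one.2 ⟨r, h1⟩
  · apply le_antisymm
    · intro z hz
      rw [Submodule.mem_div_iff_forall_mul_mem] at hz
      have h1 : (1 : FractionRing R) ∈ 1 / idealToFrac R P := by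
        rw [Submodule.mem_div_iff_forall_mul_mem]
        intro p hp
        obtain ⟨r, hr, rfl⟩ := (sd_mem_idealToFrac P p).1 hp
        exact Submodule.mem_one.2 ⟨r, by simp⟩
      obtain ⟨q, hq⟩ := Submodule.mem_one.1 (hz 1 h1)
      rw [mul_one] at hq
      subst hq
      rw [sd_coe_mem, h]
      intro y hy
      rw [← sd_coe_mem, ← show _ = idealToFrac R I from hdiv,
        Submodule.mem_div_iff_forall_mul_mem]
      intro w hw
      rw [map_mul, mul_assoc]
      apply hz
      rw [Submodule.mem_div_iff_forall_mul_mem] at hw ⊢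
      intro p hp
      obtain ⟨r, hr, rfl⟩ := (sd_mem_idealToFrac P p).1 hp
      have h2 := hw _ ((sd_coe_mem I _).2 ((h r).1 hr y hy))
      rw [map_mul] at h2
      convert h2 using 1
      ring
    · intro x hx
      rw [Submodule.mem_div_iff_forall_mul_mem]
      intro w hw
      rw [Submodule.mem_div_iff_forall_mul_mem] at hw
      rw [mul_comm]
      exact hw x hx

/-- If a domain `R` has a nonzero proper strongly divisorial ideal `I` containing a
power of its radical, and `√I = ⋂ P_λ` is an irredundant intersection of primes, then
every prime `P_λ` in this intersection is (nonzero and) strongly divisorial. -/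
theorem strongly_divisorial_primes_over_strongly_divisorial {R : Type*} [CommRing R]
    [IsDomain R] {Λ : Type*}
    (I : Ideal R) (hne : I ≠ ⊥) (hproper : I ≠ ⊤)
    (hstrong : IsStrong R I) (hdiv : IsDivisorial R I)
    (n : ℕ) (hn : 1 ≤ n) (hpow : I.radical ^ n ≤ I)
    (P : Λ → Ideal R) (hP : ∀ l, (P l).IsPrime)
    (hI : I.radical = ⨅ l, P l)
    (hirr : ∀ μ : Λ, ¬ (⨅ (l) (_ : l ≠ μ), P l) ≤ P μ) :
    ∀ l, P l ≠ ⊥ ∧ IsStrong R (P l) ∧ IsDivisorial R (P l) := by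
  classical
  intro l
  have hIP : I ≤ P l := Ideal.le_radical.trans (hI ▸ iInf_le P l)
  refine ⟨fun h0 => hne (le_bot_iff.1 (h0 ▸ hIP)), ?_⟩
  obtain ⟨a, haJ, haP⟩ := SetLike.not_le_iff_exists.1 (hirr l)
  have hpr := hP l
  have hex : ∃ m : ℕ, ∃ s, s ∉ P l ∧ ∀ y ∈ P l ^ m, y * s ∈ I := by
    refine ⟨n, a ^ n, fun h => haP (hpr.mem_of_pow_mem _ h), fun y hy => ?_⟩
    have hle : P l * Ideal.span {a} ≤ I.radical := by
      rw [hI, Ideal.mul_le]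
      intro r hr t ht
      rw [Ideal.mem_iInf]
      intro k
      by_cases hk : k = l
      · subst hk
        exact Ideal.mul_mem_right _ _ hr
      · apply Ideal.mul_mem_left
        have h1 : a ∈ P k := by
          simp only [Ideal.mem_iInf] at haJ
          exact haJ k hk
        exact (Ideal.span_singleton_le_iff_mem (P k)).2 h1 ht
    apply hpow
    apply Ideal.pow_right_mono hle n
    rw [mul_pow]
    exact Ideal.mul_mem_mul hy (Ideal.pow_mem_pow (Ideal.mem_span_singleton_self a) n)
  obtain ⟨s, hs, hms⟩ := Nat.find_spec hex
  have hmin := fun k => Nat.find_min hex (m := k)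
  generalize Nat.find hex = m at hms hmin
  cases m with
  | zero =>
    refine absurd (hIP ?_) hs
    simpa using hms 1 (by simp)
  | succ k =>
    refine sd_residual I (P l) {z | ∃ y ∈ P l ^ k, z = y * s} hstrong hdiv hIP fun r => ?_
    constructor
    · rintro hr _ ⟨y, hy, rfl⟩
      rw [← mul_assoc]
      apply hms
      rw [pow_succ']
      exact Ideal.mul_mem_mul hr hy
    · intro h
      by_contra hr
      refine hmin k (Nat.lt_succ_self k) ⟨r * s, ?_, fun y hy => ?_⟩
      · intro hrs
        exact (hpr.mem_or_mem hrs).elim hr hs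
      · have := h _ ⟨y, hy, rfl⟩
        convert this using 1
        ring
end

section
/- Let R be a seminormal integral domain with quotient field K, let T be an overring of R (a ring with R ⊆ T ⊆ K), and let I = (R : T) = {x ∈ K | xT ⊆ R}. Then I is a radical ideal of T and a radical ideal of R (i.e., for t ∈ T, t² ∈ I implies t ∈ I, and likewise for t ∈ R). -/
/-! Basic notions: for an integral domain `R` with fraction field `K`, an ideal `I`
is viewed as the submodule `idealToFrac R I` of `K`; `1 / M` is the Mathlib
submodule quotient `(R : M) = {x ∈ K | x M ⊆ R}` and `M / N = {x ∈ K | x N ⊆ M}`. -/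

variable (R : Type*) [CommRing R] [IsDomain R]

/-- Let `R` be a seminormal domain, `T` an overring of `R` (a subring of `K = Frac R`
containing `R`), and `I = (R : T) = {x ∈ K | x T ⊆ R}`. Then `I` is radical in both
`T` and `R`: for `t ∈ T` (in particular for `t ∈ R`), `t² ∈ I` implies `t ∈ I`. -/
theorem conductor_radical_of_seminormal {R : Type*} [CommRing R] [IsDomain R]
    (hsn : Seminormal R) (T : Subalgebra R (FractionRing R))
    (I : Set (FractionRing R))
    (hI : ∀ x : FractionRing R,
      x ∈ I ↔ ∀ y ∈ T, x * y ∈ (algebraMap R (FractionRing R)).range) :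
    (∀ t ∈ T, t ^ 2 ∈ I → t ∈ I) ∧
    (∀ r : R, (algebraMap R (FractionRing R) r) ^ 2 ∈ I →
      algebraMap R (FractionRing R) r ∈ I) := by
  have key : ∀ t ∈ T, t ^ 2 ∈ I → t ∈ I := by
    intro t ht h2
    rw [hI] at h2 ⊢
    intro y hy
    apply hsn
    · have := h2 (y ^ 2) (T.pow_mem hy 2)
      rwa [← mul_pow] at this
    · have := h2 (t * y ^ 3) (T.mul_mem ht (T.pow_mem hy 3))
      have e : (t * y) ^ 3 = t ^ 2 * (t * y ^ 3) := by ring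
      rwa [e]
  exact ⟨key, fun r hr => key _ (T.algebraMap_mem r) hr⟩
end

section
/- Let R be an integral domain with quotient field K and let T be a ring with R ⊊ T ⊆ K such that (R : T) = {x ∈ K | xT ⊆ R} is nonzero. If T is Noetherian, then R has a strongly divisorial prime ideal. -/
/-! Basic notions: for an integral domain `R` with fraction field `K`, an ideal `I`
is viewed as the submodule `idealToFrac R I` of `K`; `1 / M` is the Mathlib
submodule quotient `(R : M) = {x ∈ K | x M ⊆ R}` and `M / N = {x ∈ K | x N ⊆ M}`. -/

variable (R : Type*) [CommRing R] [IsDomain R]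

/-- Let `R ⊊ T ⊆ K = Frac R` with `(R : T) ≠ 0`. If `T` is Noetherian, then `R` has a
(nonzero) strongly divisorial prime ideal. -/
theorem exists_strongly_divisorial_prime_of_noetherian_overring {R : Type*} [CommRing R]
    [IsDomain R] (T : Subalgebra R (FractionRing R))
    (hproper : ∃ t ∈ T, t ∉ (algebraMap R (FractionRing R)).range)
    (hcond : ∃ x : FractionRing R, x ≠ 0 ∧
      ∀ y ∈ T, x * y ∈ (algebraMap R (FractionRing R)).range)
    (hnoeth : IsNoetherianRing T) :
    ∃ P : Ideal R, P.IsPrime ∧ P ≠ ⊥ ∧ IsStrong R P ∧ IsDivisorial R P := by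
  classical
  set ι := algebraMap R (FractionRing R) with hι
  have hinj : Function.Injective ι := IsFractionRing.injective R (FractionRing R)
  -- `J a = (C :_T a)` where `C = (R : T)`
  let J : R → Ideal T := fun a =>
    { carrier := {t | ∀ s ∈ T, ι a * (t : FractionRing R) * s ∈ ι.range}
      zero_mem' := by
        intro s _
        simp
      add_mem' := by
        intro x y hx hy s hs
        have h := ι.range.add_mem (hx s hs) (hy s hs)
        have e : ι a * ((x + y : T) : FractionRing R) * s = ι a * x * s + ι a * y * s := by
          push_cast; ring
        rw [e]; exact h
      smul_mem' := by
        intro c x hx s hs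
        have h := hx (c * s) (T.mul_mem c.2 hs)
        have e : ι a * ((c • x : T) : FractionRing R) * s = ι a * x * (c * s) := by
          simp only [smul_eq_mul, MulMemClass.coe_mul]; ring
        rw [e]; exact h }
  have hJ : ∀ a (t : T), t ∈ J a ↔ ∀ s ∈ T, ι a * (t : FractionRing R) * s ∈ ι.range :=
    fun a t => Iff.rfl
  let N : Set R := {a | ∃ s ∈ T, ι a * s ∉ ι.range}
  have h1N : (1 : R) ∈ N := by
    obtain ⟨t, ht, h⟩ := hproper
    exact ⟨t, ht, by simpa using h⟩
  obtain ⟨M, ⟨a, haN, rfl⟩, hmax⟩ :=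
    set_has_maximal_iff_noetherian.mpr hnoeth (J '' N) ⟨_, 1, h1N, rfl⟩
  let P : Ideal R :=
    { carrier := {r | ∀ s ∈ T, ι r * ι a * s ∈ ι.range}
      zero_mem' := by
        intro s _
        simp
      add_mem' := by
        intro x y hx hy s hs
        have h := ι.range.add_mem (hx s hs) (hy s hs)
        have e : ι (x + y) * ι a * s = ι x * ι a * s + ι y * ι a * s := by
          rw [map_add]; ring
        rw [e]; exact h
      smul_mem' := by
        intro c x hx s hs
        have h := ι.range.mul_mem ⟨c, rfl⟩ (hx s hs)
        have e : ι (c • x) * ι a * s = ι c * (ι x * ι a * s) := by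
          rw [smul_eq_mul, map_mul]; ring
        rw [e]; exact h }
  have hP : ∀ r, r ∈ P ↔ ∀ s ∈ T, ι r * ι a * s ∈ ι.range := fun r => Iff.rfl
  have h1 : (1 : R) ∉ P := by
    intro h
    obtain ⟨s, hs, h'⟩ := haN
    have := (hP 1).1 h s hs
    rw [map_one, one_mul] at this
    exact h' this
  have hmem1 : ∀ y : FractionRing R, y ∈ (1 : Submodule R (FractionRing R)) ↔ y ∈ ι.range := by
    intro y
    rw [Submodule.mem_one]; rfl
  have hmemP : ∀ y, y ∈ idealToFrac R P ↔ ∃ r ∈ P, ι r = y := by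
    intro y; rfl
  refine ⟨P, ⟨?_, ?_⟩, ?_, ?_, ?_⟩
  · exact (Ideal.ne_top_iff_one P).2 h1
  · intro r s hrs
    by_contra! hcon
    obtain ⟨hr, hs⟩ := hcon
    have hsN : s * a ∈ N := by
      by_contra h
      apply hs
      intro t ht
      by_contra h2
      exact h ⟨t, ht, by rwa [map_mul]⟩
    have hle : J a ≤ J (s * a) := by
      intro t ht u hu
      have h := ι.range.mul_mem ⟨s, rfl⟩ (ht u hu)
      have e : ι (s * a) * (t : FractionRing R) * u = ι s * (ι a * t * u) := by
        rw [map_mul]; ring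
      rw [e]; exact h
    have heq : J a = J (s * a) := by
      by_contra hne
      exact hmax _ ⟨_, hsN, rfl⟩ (lt_of_le_of_ne hle hne)
    have hr' : algebraMap R T r ∈ J (s * a) := by
      intro u hu
      have h := hrs u hu
      have e : ι (s * a) * ((algebraMap R T r : T) : FractionRing R) * u
          = ι (r * s) * ι a * u := by
        change ι (s * a) * ι r * u = _
        rw [map_mul, map_mul]; ring
      rw [e]; exact h
    rw [← heq] at hr'
    apply hr
    intro u hu
    have h := hr' u hu
    change ι a * ι r * u ∈ _ at h
    rwa [mul_comm (ι a)] at h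
  · obtain ⟨x, hx0, hx⟩ := hcond
    obtain ⟨c, hc⟩ := hx 1 T.one_mem
    rw [mul_one] at hc
    intro hbot
    have hcP : c ∈ P := by
      intro s hs
      have h := ι.range.mul_mem ⟨a, rfl⟩ (hx s hs)
      have e : ι c * ι a * s = ι a * (x * s) := by
        rw [hc]; ring
      rw [e]; exact h
    rw [hbot, Ideal.mem_bot] at hcP
    apply hx0
    rw [← hc, hcP, map_zero]
  · -- strong
    unfold IsStrong
    ext x
    rw [Submodule.mem_div_iff_forall_mul_mem, Submodule.mem_div_iff_forall_mul_mem]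
    constructor
    · intro h y hy
      obtain ⟨w, hw⟩ := (hmem1 _).1 (h y hy)
      obtain ⟨q, hq, rfl⟩ := (hmemP y).1 hy
      refine (hmemP _).2 ⟨w, ?_, hw⟩
      intro s hs
      obtain ⟨d, hd⟩ := hq s hs
      have hdP : d ∈ P := by
        intro u hu
        have h2 := ι.range.mul_mem ⟨a, rfl⟩ (hq (s * u) (T.mul_mem hs hu))
        have e : ι d * ι a * u = ι a * (ι q * ι a * (s * u)) := by
          rw [hd]; ring
        rw [e]; exact h2
      have h3 := (hmem1 _).1 (h (ι d) ((hmemP _).2 ⟨d, hdP, rfl⟩))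
      have e : ι w * ι a * s = x * ι d := by
        rw [hw, hd]; ring
      rw [e]; exact h3
    · intro h y hy
      obtain ⟨w, _, hw⟩ := (hmemP _).1 (h y hy)
      exact (hmem1 _).2 ⟨w, hw⟩
  · -- divisorial
    unfold IsDivisorial
    ext y
    rw [Submodule.mem_div_iff_forall_mul_mem]
    constructor
    · intro h
      obtain ⟨r, hr⟩ := (hmem1 _).1 (h 1 (by
        rw [Submodule.mem_div_iff_forall_mul_mem]
        intro z hz
        obtain ⟨q, _, rfl⟩ := (hmemP z).1 hz
        exact (hmem1 _).2 ⟨q, by rw [one_mul]⟩))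
      rw [mul_one] at hr
      refine (hmemP _).2 ⟨r, ?_, hr⟩
      intro s hs
      have h2 := (hmem1 _).1 (h (ι a * s) (by
        rw [Submodule.mem_div_iff_forall_mul_mem]
        intro z hz
        obtain ⟨q, hq, rfl⟩ := (hmemP z).1 hz
        have e : ι a * s * ι q = ι q * ι a * s := by ring
        rw [hmem1, e]
        exact hq s hs))
      rw [hr, mul_assoc]; exact h2
    · intro hy z hz
      rw [Submodule.mem_div_iff_forall_mul_mem] at hz
      rw [mul_comm]
      exact hz y hy
end

section
/- Let R be an integral domain such that every maximal t-ideal of R is divisorial. If R has no strongly divisorial prime ideals, then R is completely integrally closed. -/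
/-! Basic notions: for an integral domain `R` with fraction field `K`, an ideal `I`
is viewed as the submodule `idealToFrac R I` of `K`; `1 / M` is the Mathlib
submodule quotient `(R : M) = {x ∈ K | x M ⊆ R}` and `M / N = {x ∈ K | x N ⊆ M}`. -/

variable (R : Type*) [CommRing R] [IsDomain R]

theorem mem_idealToFrac_iff {R : Type*} [CommRing R] [IsDomain R] {I : Ideal R}
    {z : FractionRing R} :
    z ∈ idealToFrac R I ↔ ∃ r ∈ I, algebraMap R (FractionRing R) r = z := by
  simp [idealToFrac, Submodule.mem_map]

theorem map_mem_idealToFrac_iff {R : Type*} [CommRing R] [IsDomain R] {I : Ideal R} {r : R} :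
    algebraMap R (FractionRing R) r ∈ idealToFrac R I ↔ r ∈ I := by
  rw [mem_idealToFrac_iff]
  constructor
  · rintro ⟨s, hs, h⟩
    rwa [← IsFractionRing.injective R (FractionRing R) h]
  · intro h
    exact ⟨r, h, rfl⟩

theorem mem_inv_iff {R : Type*} [CommRing R] [IsDomain R]
    {M : Submodule R (FractionRing R)} {w : FractionRing R} :
    w ∈ 1 / M ↔ ∀ m ∈ M, ∃ r, algebraMap R (FractionRing R) r = w * m := by
  simp [Submodule.mem_div_iff_forall_mul_mem, Submodule.mem_one]

theorem mem_vOp_iff {R : Type*} [CommRing R] [IsDomain R]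
    {M : Submodule R (FractionRing R)} {z : FractionRing R} :
    z ∈ vOp R M ↔ ∀ w ∈ 1 / M, ∃ r, algebraMap R (FractionRing R) r = z * w :=
  mem_inv_iff

theorem le_vOp {R : Type*} [CommRing R] [IsDomain R]
    (M : Submodule R (FractionRing R)) : M ≤ vOp R M := by
  intro z hz
  rw [mem_vOp_iff]
  intro w hw
  rw [mul_comm]
  exact mem_inv_iff.1 hw z hz

theorem isTIdeal_iff {R : Type*} [CommRing R] [IsDomain R] {I : Ideal R} :
    IsTIdeal R I ↔ ∀ J : Ideal R, J.FG → J ≤ I →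
      ∀ z : R, algebraMap R (FractionRing R) z ∈ vOp R (idealToFrac R J) → z ∈ I := by
  constructor
  · intro h J hJ hJI z hz
    rw [← map_mem_idealToFrac_iff, ← h]
    have : vOp R (idealToFrac R J) ≤ tClosure R (idealToFrac R I) :=
      le_iSup_of_le _ (le_iSup_of_le (Submodule.FG.map _ hJ)
        (le_iSup_of_le (Submodule.map_mono hJI) le_rfl))
    exact this hz
  · intro h
    apply le_antisymm
    · refine iSup_le fun J => iSup_le fun hJ => iSup_le fun hJI => ?_
      intro z hz
      have hinj : Function.Injective (Algebra.linearMap R (FractionRing R)) :=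
        IsFractionRing.injective R (FractionRing R)
      have hJ' : idealToFrac R (J.comap (Algebra.linearMap R (FractionRing R))) = J := by
        apply Submodule.map_comap_eq_of_le
        refine hJI.trans ?_
        rintro _ ⟨r, _, rfl⟩
        exact ⟨r, rfl⟩
      have hone : (1 : FractionRing R) ∈ 1 / J := by
        rw [mem_inv_iff]
        intro m hm
        obtain ⟨r, _, hr⟩ := mem_idealToFrac_iff.1 (hJI hm)
        exact ⟨r, by rw [hr, one_mul]⟩
      obtain ⟨r, hr⟩ := mem_vOp_iff.1 hz 1 hone
      rw [mul_one] at hr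
      subst hr
      rw [map_mem_idealToFrac_iff]
      refine h (J.comap (Algebra.linearMap R (FractionRing R))) ?_ ?_ r ?_
      · apply Submodule.fg_of_fg_map_injective _ hinj
        change (idealToFrac R _).FG
        rw [hJ']
        exact hJ
      · intro t ht
        exact map_mem_idealToFrac_iff.1 (hJI ht)
      · rw [hJ']
        exact hz
    · intro z hz
      have h1 : Submodule.span R {z} ≤ idealToFrac R I := by
        rw [Submodule.span_singleton_le_iff_mem]
        exact hz
      have : vOp R (Submodule.span R {z}) ≤ tClosure R (idealToFrac R I) :=
        le_iSup_of_le _ (le_iSup_of_le (Submodule.fg_span_singleton z)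
          (le_iSup_of_le h1 le_rfl))
      exact this (le_vOp _ (Submodule.mem_span_singleton_self z))

theorem exists_maximalTIdeal {R : Type*} [CommRing R] [IsDomain R] {I : Ideal R}
    (hI : I ≠ ⊤) (ht : IsTIdeal R I) : ∃ M : Ideal R, I ≤ M ∧ IsMaximalTIdeal R M := by
  obtain ⟨M, hIM, hM⟩ := zorn_le_nonempty₀ {J : Ideal R | J ≠ ⊤ ∧ IsTIdeal R J} (by
    intro c hc hchain y hy
    have hdir : DirectedOn (· ≤ ·) c := hchain.directedOn
    refine ⟨sSup c, ⟨?_, ?_⟩, fun z hz => le_sSup hz⟩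
    · intro htop
      have h1 : (1 : R) ∈ sSup c := by rw [htop]; trivial
      obtain ⟨J, hJ, h1J⟩ := (Submodule.mem_sSup_of_directed ⟨y, hy⟩ hdir).1 h1
      exact (hc hJ).1 ((Ideal.eq_top_iff_one J).2 h1J)
    · rw [isTIdeal_iff]
      intro J hJ hJc z hz
      obtain ⟨N, hN, hJN⟩ : ∃ N ∈ c, J ≤ N := by
        obtain ⟨S, hS⟩ := hJ
        have : ∃ N ∈ c, (S : Set R) ⊆ N := by
          apply DirectedOn.exists_mem_subset_of_finset_subset_biUnion (f := fun N : Ideal R => (N : Set R)) ⟨y, hy⟩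
          · exact hdir
          · intro s hs
            have hs' : s ∈ sSup c := hJc (hS ▸ Submodule.subset_span hs)
            obtain ⟨N, hN, hsN⟩ := (Submodule.mem_sSup_of_directed ⟨y, hy⟩ hdir).1 hs'
            exact Set.mem_biUnion hN hsN
        obtain ⟨N, hN, hSN⟩ := this
        exact ⟨N, hN, hS ▸ Submodule.span_le.2 hSN⟩
      exact le_sSup hN (isTIdeal_iff.1 (hc hN).2 J hJ hJN z hz)) I ⟨hI, ht⟩
  refine ⟨M, hIM, hM.prop.1, hM.prop.2, fun J hJ hJt hMJ => ?_⟩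
  exact (hM.eq_of_le ⟨hJ, hJt⟩ hMJ).symm

theorem IsMaximalTIdeal.isPrime' {R : Type*} [CommRing R] [IsDomain R] {M : Ideal R}
    (hM : IsMaximalTIdeal R M) : M.IsPrime := by
  refine ⟨hM.1, ?_⟩
  intro r s hrs
  by_contra! hcon
  obtain ⟨hr, hs⟩ := hcon
  let J : Ideal R := Submodule.comap (LinearMap.mulLeft R r) M
  have memJ : ∀ t, t ∈ J ↔ r * t ∈ M := fun t => Iff.rfl
  have hJ : J = M := by
    apply hM.2.2
    · intro h
      apply hr
      have := (memJ 1).1 (h ▸ trivial)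
      rwa [mul_one] at this
    · rw [isTIdeal_iff]
      intro F hF hFJ z hz
      rw [memJ]
      refine isTIdeal_iff.1 hM.2.1 (Submodule.map (LinearMap.mulLeft R r) F)
        (Submodule.FG.map _ hF)
        (Submodule.map_le_iff_le_comap.2 hFJ) _ ?_
      rw [mem_vOp_iff] at hz ⊢
      intro w hw
      obtain ⟨q, hq⟩ := hz (algebraMap R (FractionRing R) r * w) (by
        rw [mem_inv_iff] at hw ⊢
        intro m hm
        obtain ⟨f, hf, rfl⟩ := mem_idealToFrac_iff.1 hm
        obtain ⟨q, hq⟩ := hw (algebraMap R (FractionRing R) (r * f))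
          (map_mem_idealToFrac_iff.2 ⟨f, hf, rfl⟩)
        exact ⟨q, by rw [hq, map_mul]; ring⟩)
      exact ⟨q, by rw [hq, map_mul]; ring⟩
    · intro t ht
      exact M.mul_mem_left r ht
  exact hs (hJ ▸ (memJ s).2 hrs)

/-- The ideal of elements infinitely divisible by `a` after localizing at the prime `M`. -/
def infDivIdeal {R : Type*} [CommRing R] (M : Ideal R) (hM : M.IsPrime) (a : R) : Ideal R where
  carrier := {r | ∀ n : ℕ, ∃ u ∉ M, a ^ n ∣ u * r}
  zero_mem' := fun n => ⟨1, fun h => hM.ne_top ((Ideal.eq_top_iff_one M).2 h), by simp⟩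
  add_mem' := by
    intro r s hr hs n
    obtain ⟨u, hu, hur⟩ := hr n
    obtain ⟨v, hv, hvs⟩ := hs n
    refine ⟨u * v, fun h => (hM.mem_or_mem h).elim hu hv, ?_⟩
    have : u * v * (r + s) = v * (u * r) + u * (v * s) := by ring
    rw [this]
    exact dvd_add (hur.mul_left _) (hvs.mul_left _)
  smul_mem' := by
    intro c r hr n
    obtain ⟨u, hu, hur⟩ := hr n
    refine ⟨u, hu, ?_⟩
    rw [smul_eq_mul, mul_left_comm]
    exact hur.mul_left _

theorem mem_infDivIdeal {R : Type*} [CommRing R] {M : Ideal R} {hM : M.IsPrime} {a r : R} :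
    r ∈ infDivIdeal M hM a ↔ ∀ n : ℕ, ∃ u ∉ M, a ^ n ∣ u * r := Iff.rfl

theorem exists_factor {R : Type*} [CommRing R] {M : Ideal R} {hM : M.IsPrime} {a s : R}
    (hs : s ∉ M) (hsM : ∀ m ∈ M, a ∣ s * m) {r : R} (hr : r ∉ infDivIdeal M hM a) :
    ∃ (n : ℕ) (u r' : R), u ∉ M ∧ r' ∉ M ∧ u * r = a ^ n * r' := by
  classical
  rw [mem_infDivIdeal, not_forall] at hr
  have h0 := Nat.find_spec hr
  have hmin := fun m => @Nat.find_min _ _ hr m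
  generalize Nat.find hr = N at h0 hmin
  cases N with
  | zero =>
    exact absurd ⟨1, fun h => hM.ne_top ((Ideal.eq_top_iff_one M).2 h), by simp⟩ h0
  | succ n =>
    obtain ⟨u, hu, r', hr'⟩ := not_not.1 (hmin n n.lt_succ_self)
    refine ⟨n, u, r', hu, fun hmem => h0 ?_, hr'⟩
    obtain ⟨t, ht⟩ := hsM r' hmem
    refine ⟨s * u, fun h => (hM.mem_or_mem h).elim hs hu, t, ?_⟩
    calc s * u * r = s * (u * r) := by ring
      _ = a ^ n * (s * r') := by rw [hr']; ring
      _ = a ^ (n + 1) * t := by rw [ht]; ring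

theorem infDivIdeal_isPrime {R : Type*} [CommRing R] [IsDomain R] {M : Ideal R}
    {hM : M.IsPrime} {a s : R} (ha : a ∈ M) (ha0 : a ≠ 0)
    (hs : s ∉ M) (hsM : ∀ m ∈ M, a ∣ s * m) : (infDivIdeal M hM a).IsPrime := by
  constructor
  · intro h
    have h1 : (1 : R) ∈ infDivIdeal M hM a := h ▸ trivial
    obtain ⟨u, hu, t, ht⟩ := h1 1
    apply hu
    rw [mul_one, pow_one] at ht
    rw [ht]
    exact M.mul_mem_right t ha
  · intro p q hpq
    by_contra! hcon
    obtain ⟨i, u, p', hu, hp', hp⟩ := exists_factor hs hsM hcon.1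
    obtain ⟨j, v, q', hv, hq', hq⟩ := exists_factor hs hsM hcon.2
    obtain ⟨w, hw, t, ht⟩ := hpq (i + j + 1)
    have key : w * (p' * q') = a * (u * v * t) := by
      apply mul_left_cancel₀ (pow_ne_zero (i + j) ha0)
      calc a ^ (i + j) * (w * (p' * q')) = w * (a ^ i * p') * (a ^ j * q') := by ring
        _ = u * v * (w * (p * q)) := by rw [← hp, ← hq]; ring
        _ = a ^ (i + j) * (a * (u * v * t)) := by rw [ht]; ring
    have hmem : w * (p' * q') ∈ M := key ▸ M.mul_mem_right _ ha
    exact (hM.mem_or_mem hmem).elim hw fun h => (hM.mem_or_mem h).elim hp' hq'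

theorem infDivIdeal_strong_div {R : Type*} [CommRing R] [IsDomain R] {M : Ideal R}
    {hM : M.IsPrime} {a s : R} (ha : a ∈ M) (ha0 : a ≠ 0)
    (hs : s ∉ M) (hsM : ∀ m ∈ M, a ∣ s * m) :
    IsStrong R (infDivIdeal M hM a) ∧ IsDivisorial R (infDivIdeal M hM a) := by
  set P := infDivIdeal M hM a with hP
  set φ := algebraMap R (FractionRing R) with hφ
  have hinj : Function.Injective φ := IsFractionRing.injective R (FractionRing R)
  have hφa : φ a ≠ 0 := fun h => ha0 (hinj (by rw [h, map_zero]))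
  have hPM : P ≤ M := by
    intro r hr
    obtain ⟨u, hu, t, ht⟩ := hr 1
    refine (hM.mem_or_mem (?_ : u * r ∈ M)).resolve_left hu
    rw [ht, pow_one]
    exact M.mul_mem_right t ha
  set y : FractionRing R := φ s / φ a with hy
  have hya : φ a * y = φ s := by rw [hy]; field_simp
  -- multiplication by `y` preserves `P`
  have hyP : ∀ r ∈ P, ∃ r' ∈ P, φ r' = y * φ r := by
    intro r hr
    obtain ⟨t, ht⟩ := hsM r (hPM hr)
    have e : φ t = y * φ r := by
      apply mul_left_cancel₀ hφa
      rw [← mul_assoc, hya, ← map_mul, ← map_mul, ht]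
    refine ⟨t, ?_, e⟩
    intro n
    obtain ⟨u, hu, q, hq⟩ := hr (n + 1)
    refine ⟨u, hu, s * q, ?_⟩
    apply mul_left_cancel₀ ha0
    calc a * (u * t) = u * (a * t) := by ring
      _ = s * (u * r) := by rw [← ht]; ring
      _ = a * (a ^ n * (s * q)) := by rw [hq]; ring
  have hynP : ∀ n : ℕ, ∀ r ∈ P, ∃ r' ∈ P, φ r' = y ^ n * φ r := by
    intro n
    induction n with
    | zero => intro r hr; exact ⟨r, hr, by simp⟩
    | succ n ih =>
      intro r hr
      obtain ⟨r1, hr1, e1⟩ := ih r hr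
      obtain ⟨r2, hr2, e2⟩ := hyP r1 hr1
      exact ⟨r2, hr2, by rw [e2, e1]; ring⟩
  -- membership criterion
  have crit : ∀ z : R, (∀ n : ℕ, ∃ r, φ r = y ^ n * φ z) → z ∈ P := by
    intro z hz n
    obtain ⟨r, hr⟩ := hz n
    refine ⟨s ^ n, fun h => hs (hM.mem_of_pow_mem n h), r, hinj ?_⟩
    rw [map_mul, map_mul, map_pow, map_pow, hr, ← hya]
    ring
  constructor
  · apply le_antisymm
    · intro w hw
      rw [mem_inv_iff] at hw
      rw [Submodule.mem_div_iff_forall_mul_mem]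
      intro m hm
      obtain ⟨r, hr, rfl⟩ := mem_idealToFrac_iff.1 hm
      obtain ⟨z, hz⟩ := hw _ hm
      rw [← hz, map_mem_idealToFrac_iff]
      apply crit
      intro n
      obtain ⟨r', hr', e⟩ := hynP n r hr
      obtain ⟨q, hq⟩ := hw _ (map_mem_idealToFrac_iff.2 hr')
      refine ⟨q, ?_⟩
      rw [hz]
      change φ q = w * φ r' at hq
      rw [hq, e]
      ring
    · intro w hw
      rw [Submodule.mem_div_iff_forall_mul_mem] at hw
      rw [mem_inv_iff]
      intro m hm
      obtain ⟨r, _, hr⟩ := mem_idealToFrac_iff.1 (hw m hm)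
      exact ⟨r, hr⟩
  · apply le_antisymm
    · intro z hz
      rw [mem_inv_iff] at hz
      have hyn : ∀ n : ℕ, y ^ n ∈ 1 / idealToFrac R P := by
        intro n
        rw [mem_inv_iff]
        intro m hm
        obtain ⟨r, hr, rfl⟩ := mem_idealToFrac_iff.1 hm
        obtain ⟨r', _, e⟩ := hynP n r hr
        exact ⟨r', e⟩
      obtain ⟨z', hz'⟩ := hz _ (hyn 0)
      rw [pow_zero, mul_one] at hz'
      subst hz'
      rw [map_mem_idealToFrac_iff]
      apply crit
      intro n
      obtain ⟨q, hq⟩ := hz _ (hyn n)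
      exact ⟨q, by rw [mul_comm]; exact hq⟩
    · exact le_vOp _

/-- Let `R` be a domain such that each maximal `t`-ideal is divisorial. If `R` has no
(nonzero) strongly divisorial prime ideals, then `R` is completely integrally closed. -/
theorem cic_of_no_strongly_divisorial_prime {R : Type*} [CommRing R] [IsDomain R]
    (hmax : ∀ I : Ideal R, I ≠ ⊥ → IsMaximalTIdeal R I → IsDivisorial R I)
    (hnosd : ¬ ∃ P : Ideal R, P.IsPrime ∧ P ≠ ⊥ ∧ IsStrong R P ∧ IsDivisorial R P) :
    CompletelyIntegrallyClosed R := by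
  intro x ⟨d, hd0, hd⟩
  by_contra hx
  set φ := algebraMap R (FractionRing R) with hφ
  have hinj : Function.Injective φ := IsFractionRing.injective R (FractionRing R)
  -- the conductor of `x`
  let I : Ideal R := Submodule.comap (LinearMap.toSpanSingleton R (FractionRing R) x) 1
  have memI : ∀ r, r ∈ I ↔ ∃ q, φ q = φ r * x := by
    intro r
    change r • x ∈ (1 : Submodule R (FractionRing R)) ↔ _
    rw [Submodule.mem_one, Algebra.smul_def]
  have hItop : I ≠ ⊤ := by
    intro h
    obtain ⟨q, hq⟩ := (memI 1).1 (h ▸ trivial)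
    exact hx ⟨q, by rw [hq, map_one, one_mul]⟩
  have hIt : IsTIdeal R I := by
    rw [isTIdeal_iff]
    intro J _ hJI z hz
    rw [memI]
    refine mem_vOp_iff.1 hz x ?_
    rw [mem_inv_iff]
    intro m hm
    obtain ⟨r, hr, rfl⟩ := mem_idealToFrac_iff.1 hm
    obtain ⟨q, hq⟩ := (memI r).1 (hJI hr)
    exact ⟨q, by rw [mul_comm]; exact hq⟩
  obtain ⟨M, hIM, hMmax⟩ := exists_maximalTIdeal hItop hIt
  have hM : M.IsPrime := hMmax.isPrime'
  obtain ⟨b, c, hc, hbc⟩ := IsFractionRing.div_surjective (A := R) x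
  have hc0 : c ≠ 0 := nonZeroDivisors.ne_zero hc
  have hφc : φ c ≠ 0 := fun h => hc0 (hinj (by rw [h, map_zero]))
  have hcx : φ c * x = φ b := by
    rw [← hbc]
    exact mul_div_cancel₀ _ hφc
  have hcM : c ∈ M := hIM ((memI c).2 ⟨b, hcx.symm⟩)
  have hMbot : M ≠ ⊥ := by
    rintro rfl
    exact hc0 hcM
  have hb0 : b ≠ 0 := by
    rintro rfl
    apply hx
    refine ⟨0, ?_⟩
    rw [← hbc, map_zero, zero_div]
  have hns : ¬ IsStrong R M := fun h => hnosd ⟨M, hM, hMbot, h, hmax M hMbot hMmax⟩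
  obtain ⟨a, s, ha, hs, hsM⟩ : ∃ a s : R, a ∈ M ∧ s ∉ M ∧ ∀ m ∈ M, a ∣ s * m := by
    by_contra! hcon
    apply hns
    apply le_antisymm
    · intro w hw
      rw [mem_inv_iff] at hw
      rw [Submodule.mem_div_iff_forall_mul_mem]
      intro m hm
      obtain ⟨a, ha, rfl⟩ := mem_idealToFrac_iff.1 hm
      obtain ⟨s, hs⟩ := hw _ hm
      rw [← hs, map_mem_idealToFrac_iff]
      by_contra hsM
      obtain ⟨m, hmM, hndvd⟩ := hcon a s ha hsM
      obtain ⟨q, hq⟩ := hw _ (map_mem_idealToFrac_iff.2 hmM)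
      apply hndvd
      refine ⟨q, hinj ?_⟩
      change φ s = _ * φ a at hs
      change φ q = _ * φ m at hq
      rw [map_mul, map_mul, hq, hs]
      ring
    · intro w hw
      rw [Submodule.mem_div_iff_forall_mul_mem] at hw
      rw [mem_inv_iff]
      intro m hm
      obtain ⟨r, _, hr⟩ := mem_idealToFrac_iff.1 (hw m hm)
      exact ⟨r, hr⟩
  have ha0 : a ≠ 0 := by
    rintro rfl
    have h := zero_dvd_iff.1 (hsM c hcM)
    rcases mul_eq_zero.1 h with h | h
    · exact hs (h ▸ M.zero_mem)
    · exact hc0 h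
  have hPbot : infDivIdeal M hM a = ⊥ := by
    by_contra h
    exact hnosd ⟨_, infDivIdeal_isPrime ha ha0 hs hsM, h,
      infDivIdeal_strong_div ha ha0 hs hsM⟩
  obtain ⟨i, u, c', hu, hc', hcu⟩ := exists_factor (hM := hM) hs hsM (r := c) (by
    rw [hPbot]; exact hc0)
  obtain ⟨j, v, b', hv, hb', hbv⟩ := exists_factor (hM := hM) hs hsM (r := b) (by
    rw [hPbot]; exact hb0)
  have hvc : v * c' ∉ M := fun h => (hM.mem_or_mem h).elim hv hc'
  have hub : u * b' ∉ M := fun h => (hM.mem_or_mem h).elim hu hb'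
  have hφa : φ a ≠ 0 := fun h => ha0 (hinj (by rw [h, map_zero]))
  have hcu' : φ u * φ c = φ a ^ i * φ c' := by
    rw [← map_mul, hcu, map_mul, map_pow]
  have hbv' : φ v * φ b = φ a ^ j * φ b' := by
    rw [← map_mul, hbv, map_mul, map_pow]
  have key : φ a ^ i * (φ (v * c') * x) = φ a ^ j * φ (u * b') := by
    rw [map_mul, map_mul]
    linear_combination (-(φ v * x)) * hcu' + φ u * hbv' + φ u * φ v * hcx
  rcases le_or_gt i j with hij | hij
  · obtain ⟨k, rfl⟩ := Nat.exists_eq_add_of_le hij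
    apply hvc
    apply hIM
    rw [memI]
    refine ⟨a ^ k * (u * b'), ?_⟩
    apply mul_left_cancel₀ (pow_ne_zero i hφa)
    rw [key, map_mul, map_pow]
    ring
  · obtain ⟨k, rfl⟩ := Nat.exists_eq_add_of_lt hij
    have key2 : φ (a ^ (k + 1) * (v * c')) * x = φ (u * b') := by
      apply mul_left_cancel₀ (pow_ne_zero j hφa)
      rw [← key, map_mul, map_pow]
      ring
    have hdP : d ∈ infDivIdeal M hM a := by
      intro n
      obtain ⟨e, he⟩ := hd n
      refine ⟨(u * b') ^ n, fun h => hub (hM.mem_of_pow_mem n h),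
        a ^ (k * n) * (v * c') ^ n * e, hinj ?_⟩
      change φ e = φ d * x ^ n at he
      have h1 : φ ((u * b') ^ n * d) = φ (a ^ (k + 1) * (v * c')) ^ n * (φ d * x ^ n) := by
        rw [map_mul, map_pow, ← key2]
        ring
      rw [h1, ← he, ← map_pow, ← map_mul]
      congr 1
      ring
    rw [hPbot] at hdP
    exact hd0 hdP
end

section
/- For an integral domain R the following conditions are equivalent: (1) R has no nonzero proper strong t-ideals; (2) R has no nonzero strong prime t-ideals; (3) R has no strongly divisorial prime ideals and every maximal t-ideal of R is t-invertible; (4) R has no strongly divisorial prime ideals and every maximal t-ideal of R is divisorial; (5) R is completely integrally closed and every maximal t-ideal of R is divisorial; (6) every nonzero t-ideal of R is t-invertible. -/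
/-! Basic notions: for an integral domain `R` with fraction field `K`, an ideal `I`
is viewed as the submodule `idealToFrac R I` of `K`; `1 / M` is the Mathlib
submodule quotient `(R : M) = {x ∈ K | x M ⊆ R}` and `M / N = {x ∈ K | x N ⊆ M}`. -/

variable (R : Type*) [CommRing R] [IsDomain R]

section Helpers

variable {R}

theorem h_mem_itf {I : Ideal R} {x : FractionRing R} :
    x ∈ idealToFrac R I ↔ ∃ r ∈ I, algebraMap R (FractionRing R) r = x := by
  simp [idealToFrac]

theorem h_alg_mem {I : Ideal R} {r : R} :
    algebraMap R (FractionRing R) r ∈ idealToFrac R I ↔ r ∈ I := by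
  rw [h_mem_itf]
  constructor
  · rintro ⟨s, hs, h⟩
    rwa [← IsFractionRing.injective R (FractionRing R) h]
  · intro h
    exact ⟨r, h, rfl⟩

theorem h_mem_one {x : FractionRing R} :
    x ∈ (1 : Submodule R (FractionRing R)) ↔ ∃ r : R, algebraMap R (FractionRing R) r = x := by
  simp [Submodule.mem_one]

theorem h_alg_one (r : R) :
    algebraMap R (FractionRing R) r ∈ (1 : Submodule R (FractionRing R)) := h_mem_one.2 ⟨r, rfl⟩

theorem h_one_mul {x y : FractionRing R} (hx : x ∈ (1 : Submodule R (FractionRing R)))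
    (hy : y ∈ (1 : Submodule R (FractionRing R))) :
    x * y ∈ (1 : Submodule R (FractionRing R)) := by
  obtain ⟨r, rfl⟩ := h_mem_one.1 hx
  obtain ⟨s, rfl⟩ := h_mem_one.1 hy
  rw [← map_mul]
  exact h_alg_one _

theorem h_mem_div {x : FractionRing R} {M N : Submodule R (FractionRing R)} :
    x ∈ M / N ↔ ∀ y ∈ N, x * y ∈ M := Submodule.mem_div_iff_forall_mul_mem

theorem h_itf_le_one (I : Ideal R) : idealToFrac R I ≤ 1 := by
  intro x hx
  obtain ⟨r, -, rfl⟩ := h_mem_itf.1 hx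
  exact h_alg_one r

theorem h_itf_mono {I J : Ideal R} : idealToFrac R I ≤ idealToFrac R J ↔ I ≤ J := by
  constructor
  · intro h r hr
    exact h_alg_mem.1 (h (h_alg_mem.2 hr))
  · intro h x hx
    obtain ⟨r, hr, rfl⟩ := h_mem_itf.1 hx
    exact h_alg_mem.2 (h hr)

theorem h_itf_top : idealToFrac R (⊤ : Ideal R) = 1 := by
  ext x
  simp [h_mem_itf, h_mem_one]

theorem h_exists_ideal {M : Submodule R (FractionRing R)} (h : M ≤ 1) :
    ∃ I : Ideal R, idealToFrac R I = M := by
  refine ⟨M.comap (Algebra.linearMap R (FractionRing R)), ?_⟩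
  ext x
  rw [h_mem_itf]
  constructor
  · rintro ⟨r, hr, rfl⟩
    exact hr
  · intro hx
    obtain ⟨r, rfl⟩ := h_mem_one.1 (h hx)
    exact ⟨r, hx, rfl⟩

theorem h_le_v (M : Submodule R (FractionRing R)) : M ≤ vOp R M := by
  intro x hx
  refine h_mem_div.2 fun y hy => ?_
  rw [mul_comm]
  exact h_mem_div.1 hy x hx

theorem h_v_mul {M N : Submodule R (FractionRing R)} {x : FractionRing R}
    (h : ∀ m ∈ M, x * m ∈ N) : ∀ m ∈ vOp R M, x * m ∈ vOp R N := by
  intro m hm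
  refine h_mem_div.2 fun y hy => ?_
  have : x * y ∈ 1 / M := h_mem_div.2 fun z hz => by
    have := h_mem_div.1 hy _ (h z hz)
    convert this using 1
    ring
  have := h_mem_div.1 hm _ this
  convert this using 1
  ring

theorem h_v_mono {M N : Submodule R (FractionRing R)} (h : M ≤ N) : vOp R M ≤ vOp R N := by
  intro m hm
  simpa using h_v_mul (x := 1) (M := M) (N := N) (fun m hm => by simpa using h hm) m hm

theorem h_div_v (M : Submodule R (FractionRing R)) : 1 / vOp R M = 1 / M := by
  apply le_antisymm
  · intro x hx
    exact h_mem_div.2 fun y hy => h_mem_div.1 hx y (h_le_v M hy)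
  · exact h_le_v (1 / M)

theorem h_v_v (M : Submodule R (FractionRing R)) : vOp R (vOp R M) = vOp R M := by
  change 1 / (1 / vOp R M) = _
  rw [h_div_v]
  rfl

theorem h_v_le_one {M : Submodule R (FractionRing R)} (h : M ≤ 1) : vOp R M ≤ 1 := by
  intro x hx
  have h1 : (1 : FractionRing R) ∈ 1 / M := h_mem_div.2 fun y hy => by simpa using h hy
  simpa using h_mem_div.1 hx 1 h1

theorem h_mem_t {M : Submodule R (FractionRing R)} {x : FractionRing R} :
    x ∈ tClosure R M ↔ ∃ J : Submodule R (FractionRing R), J.FG ∧ J ≤ M ∧ x ∈ vOp R J := by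
  have key : tClosure R M =
      ⨆ J : {J : Submodule R (FractionRing R) // J.FG ∧ J ≤ M}, vOp R J.1 := by
    apply le_antisymm
    · refine iSup_le fun J => iSup_le fun h1 => iSup_le fun h2 => ?_
      exact le_iSup (fun J : {J : Submodule R (FractionRing R) // J.FG ∧ J ≤ M} => vOp R J.1)
        ⟨J, h1, h2⟩
    · refine iSup_le fun J => ?_
      exact le_iSup_of_le J.1 (le_iSup_of_le J.2.1 (le_iSup_of_le J.2.2 le_rfl))
  haveI : Nonempty {J : Submodule R (FractionRing R) // J.FG ∧ J ≤ M} :=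
    ⟨⟨⊥, Submodule.fg_bot, bot_le⟩⟩
  rw [key, Submodule.mem_iSup_of_directed]
  · constructor
    · rintro ⟨J, hJ⟩
      exact ⟨J.1, J.2.1, J.2.2, hJ⟩
    · rintro ⟨J, h1, h2, h3⟩
      exact ⟨⟨J, h1, h2⟩, h3⟩
  · intro J J'
    exact ⟨⟨J.1 ⊔ J'.1, J.2.1.sup J'.2.1, sup_le J.2.2 J'.2.2⟩,
      h_v_mono le_sup_left, h_v_mono le_sup_right⟩

theorem h_le_t (M : Submodule R (FractionRing R)) : M ≤ tClosure R M := by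
  intro x hx
  refine h_mem_t.2 ⟨Submodule.span R {x}, Submodule.fg_span_singleton x, ?_, ?_⟩
  · simpa [Submodule.span_le] using hx
  · exact h_le_v _ (Submodule.mem_span_singleton_self x)

theorem h_t_mul {M N : Submodule R (FractionRing R)} {x : FractionRing R}
    (h : ∀ m ∈ M, x * m ∈ N) : ∀ m ∈ tClosure R M, x * m ∈ tClosure R N := by
  intro m hm
  obtain ⟨J, h1, h2, h3⟩ := h_mem_t.1 hm
  refine h_mem_t.2 ⟨J.map (LinearMap.mulLeft R x), h1.map _, ?_, ?_⟩
  · rintro _ ⟨y, hy, rfl⟩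
    exact h y (h2 hy)
  · exact h_v_mul (fun y hy => Submodule.mem_map.2 ⟨y, hy, rfl⟩) m h3

theorem h_t_mono {M N : Submodule R (FractionRing R)} (h : M ≤ N) :
    tClosure R M ≤ tClosure R N := by
  intro m hm
  simpa using h_t_mul (x := 1) (M := M) (N := N) (fun m hm => by simpa using h hm) m hm

theorem h_t_le_v (M : Submodule R (FractionRing R)) : tClosure R M ≤ vOp R M := by
  intro x hx
  obtain ⟨J, -, h2, h3⟩ := h_mem_t.1 hx
  exact h_v_mono h2 h3

theorem h_fg_le_t {M J : Submodule R (FractionRing R)} (hJ : J.FG) (h : J ≤ tClosure R M) :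
    ∃ J' : Submodule R (FractionRing R), J'.FG ∧ J' ≤ M ∧ J ≤ vOp R J' := by
  induction J, hJ using Submodule.fg_induction with
  | singleton x =>
    obtain ⟨J', h1, h2, h3⟩ := h_mem_t.1 (h (Submodule.mem_span_singleton_self x))
    exact ⟨J', h1, h2, by simpa [Submodule.span_le] using h3⟩
  | sup A B hA hB iA iB =>
    obtain ⟨A', a1, a2, a3⟩ := iA (le_sup_left.trans h)
    obtain ⟨B', b1, b2, b3⟩ := iB (le_sup_right.trans h)
    exact ⟨A' ⊔ B', a1.sup b1, sup_le a2 b2,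
      sup_le (a3.trans (h_v_mono le_sup_left)) (b3.trans (h_v_mono le_sup_right))⟩

theorem h_t_t (M : Submodule R (FractionRing R)) :
    tClosure R (tClosure R M) = tClosure R M := by
  apply le_antisymm _ (h_le_t _)
  intro x hx
  obtain ⟨J, h1, h2, h3⟩ := h_mem_t.1 hx
  obtain ⟨J', k1, k2, k3⟩ := h_fg_le_t h1 h2
  refine h_mem_t.2 ⟨J', k1, k2, ?_⟩
  rw [← h_v_v]
  exact h_v_mono k3 h3

theorem h_t_ideal_iff {I : Ideal R} :
    IsTIdeal R I ↔ tClosure R (idealToFrac R I) ≤ idealToFrac R I :=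
  ⟨fun h => le_of_eq h, fun h => le_antisymm h (h_le_t _)⟩

theorem h_div_isT {I : Ideal R} (h : IsDivisorial R I) : IsTIdeal R I :=
  h_t_ideal_iff.2 ((h_t_le_v _).trans (le_of_eq h))

theorem h_strong_iff {I : Ideal R} : IsStrong R I ↔
    ∀ x ∈ 1 / idealToFrac R I, ∀ y ∈ idealToFrac R I, x * y ∈ idealToFrac R I := by
  constructor
  · intro h x hx
    rw [IsStrong] at h
    rw [h] at hx
    exact h_mem_div.1 hx
  · intro h
    apply le_antisymm
    · intro x hx
      exact h_mem_div.2 (h x hx)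
    · intro x hx
      exact h_mem_div.2 fun y hy => h_itf_le_one I (h_mem_div.1 hx y hy)

/-- Maximal t-ideals exist. -/
theorem h_exists_max {I : Ideal R} (hI : I ≠ ⊤) (ht : IsTIdeal R I) :
    ∃ M : Ideal R, I ≤ M ∧ IsMaximalTIdeal R M := by
  obtain ⟨M, hIM, hM⟩ := zorn_le_nonempty₀ {J : Ideal R | J ≠ ⊤ ∧ IsTIdeal R J} (by
    intro c hc hchain J0 hJ0
    refine ⟨sSup c, ⟨?_, ?_⟩, fun z hz => le_sSup hz⟩
    · rw [Ideal.ne_top_iff_one, Submodule.mem_sSup_of_directed ⟨J0, hJ0⟩ hchain.directedOn]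
      rintro ⟨J, hJ, h1⟩
      exact (hc hJ).1 ((Ideal.eq_top_iff_one _).2 h1)
    · have key : ∀ J : Submodule R (FractionRing R), J.FG → J ≤ idealToFrac R (sSup c) →
          ∃ A ∈ c, J ≤ idealToFrac R A := by
        intro J hJ
        induction J, hJ using Submodule.fg_induction with
        | singleton x =>
          intro h
          obtain ⟨r, hr, rfl⟩ := h_mem_itf.1 (h (Submodule.mem_span_singleton_self x))
          rw [Submodule.mem_sSup_of_directed ⟨J0, hJ0⟩ hchain.directedOn] at hr
          obtain ⟨A, hA, hr⟩ := hr
          refine ⟨A, hA, ?_⟩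
          rw [Submodule.span_singleton_le_iff_mem]
          exact h_alg_mem.2 hr
        | sup X Y hX hY iX iY =>
          intro h
          obtain ⟨A, hA, hA'⟩ := iX (le_sup_left.trans h)
          obtain ⟨B, hB, hB'⟩ := iY (le_sup_right.trans h)
          obtain ⟨C, hC, h1, h2⟩ := hchain.directedOn A hA B hB
          exact ⟨C, hC, sup_le (hA'.trans (h_itf_mono.2 h1)) (hB'.trans (h_itf_mono.2 h2))⟩
      refine h_t_ideal_iff.2 fun x hx => ?_
      obtain ⟨J, h1, h2, h3⟩ := h_mem_t.1 hx
      obtain ⟨A, hA, hJA⟩ := key J h1 h2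
      refine h_itf_mono.2 (le_sSup hA) ?_
      exact h_t_ideal_iff.1 (hc hA).2 (h_mem_t.2 ⟨J, h1, hJA, h3⟩)) I ⟨hI, ht⟩
  exact ⟨M, hIM, hM.prop.1, hM.prop.2, fun J h1 h2 h3 =>
    le_antisymm (hM.le_of_ge ⟨h1, h2⟩ h3) h3⟩

theorem h_max_prime {M : Ideal R} (hM : IsMaximalTIdeal R M) : M.IsPrime := by
  refine ⟨hM.1, ?_⟩
  intro x y hxy
  by_contra! hcon
  obtain ⟨hx, hy⟩ := hcon
  set J : Ideal R := Submodule.comap (LinearMap.mulLeft R y) M with hJ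
  have memJ : ∀ r, r ∈ J ↔ y * r ∈ M := fun r => Iff.rfl
  have h1 : J ≠ ⊤ := by
    rw [Ideal.ne_top_iff_one, memJ]
    simpa using hy
  have h2 : M ≤ J := fun r hr => (memJ r).2 (M.mul_mem_left _ hr)
  have h3 : IsTIdeal R J := by
    refine h_t_ideal_iff.2 fun z hz => ?_
    have hz1 : z ∈ (1 : Submodule R (FractionRing R)) :=
      h_v_le_one (h_itf_le_one J) (h_t_le_v _ hz)
    obtain ⟨r, rfl⟩ := h_mem_one.1 hz1
    have := h_t_mul (x := algebraMap R _ y) (M := idealToFrac R J) (N := idealToFrac R M) (by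
      intro m hm
      obtain ⟨s, hs, rfl⟩ := h_mem_itf.1 hm
      rw [← map_mul]
      exact h_alg_mem.2 hs) _ hz
    have := h_t_ideal_iff.1 hM.2.1 this
    rw [← map_mul] at this
    exact h_alg_mem.2 ((memJ r).2 (h_alg_mem.1 this))
  have h4 := hM.2.2 J h1 h3 h2
  apply hx
  rw [← h4, memJ, mul_comm]
  exact hxy

theorem h_principal_t {a : R} (ha : a ≠ 0) : IsTIdeal R (Ideal.span {a}) := by
  have ha' : algebraMap R (FractionRing R) a ≠ 0 := by
    simpa using ha
  apply h_div_isT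
  apply le_antisymm _ (h_le_v _)
  intro x hx
  have h1 : (algebraMap R (FractionRing R) a)⁻¹ ∈ 1 / idealToFrac R (Ideal.span {a}) := by
    refine h_mem_div.2 fun y hy => ?_
    obtain ⟨r, hr, rfl⟩ := h_mem_itf.1 hy
    obtain ⟨s, rfl⟩ := Ideal.mem_span_singleton'.1 hr
    rw [map_mul, mul_comm, mul_assoc, mul_inv_cancel₀ ha', mul_one]
    exact h_alg_one s
  obtain ⟨r, hr⟩ := h_mem_one.1 (h_mem_div.1 hx _ h1)
  refine h_mem_itf.2 ⟨r * a, Ideal.mem_span_singleton'.2 ⟨r, rfl⟩, ?_⟩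
  rw [map_mul, hr, mul_assoc, inv_mul_cancel₀ ha', mul_one]

theorem h_max_ne_bot {M : Ideal R} (hM : IsMaximalTIdeal R M) : M ≠ ⊥ := by
  rintro rfl
  have hunit : ∀ a : R, a ≠ 0 → IsUnit a := by
    intro a ha
    by_contra hu
    have := hM.2.2 (Ideal.span {a}) (by rwa [Ne, Ideal.span_singleton_eq_top])
      (h_principal_t ha) bot_le
    exact ha (by simpa using this)
  have h1 : (1 : FractionRing R) ∈ tClosure R (idealToFrac R (⊥ : Ideal R)) := by
    refine h_mem_t.2 ⟨⊥, Submodule.fg_bot, bot_le, h_mem_div.2 fun y _ => ?_⟩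
    obtain ⟨a, b, hb, rfl⟩ := IsFractionRing.div_surjective (A := R) y
    obtain ⟨u, rfl⟩ := hunit b (nonZeroDivisors.ne_zero hb)
    refine h_mem_one.2 ⟨a * ↑u⁻¹, ?_⟩
    have hu : algebraMap R (FractionRing R) (u : R) ≠ 0 := by simp
    rw [one_mul, eq_div_iff hu, ← map_mul, mul_assoc, Units.inv_mul, mul_one]
  have h2 := h_t_ideal_iff.1 hM.2.1 h1
  rw [← map_one (algebraMap R (FractionRing R)), h_alg_mem] at h2
  simp at h2

theorem h_mul_div_le_one (I : Ideal R) : idealToFrac R I * (1 / idealToFrac R I) ≤ 1 := by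
  rw [Submodule.mul_le]
  intro x hx y hy
  rw [mul_comm]
  exact h_mem_div.1 hy x hx

theorem h_le_mul_div (I : Ideal R) :
    idealToFrac R I ≤ idealToFrac R I * (1 / idealToFrac R I) := by
  intro x hx
  have h1 : (1 : FractionRing R) ∈ 1 / idealToFrac R I :=
    h_mem_div.2 fun y hy => by simpa using h_itf_le_one I hy
  simpa using Submodule.mul_mem_mul hx h1

/-- If `I` is not t-invertible, `(I (R : I))_t` is a proper strong t-ideal containing `I`. -/
theorem h_not_tinv {I : Ideal R} (h : ¬ IsTInvertible R I) :
    ∃ J : Ideal R, idealToFrac R J = tClosure R (idealToFrac R I * (1 / idealToFrac R I)) ∧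
      J ≠ ⊤ ∧ IsTIdeal R J ∧ I ≤ J ∧ IsStrong R J := by
  obtain ⟨J, hJ⟩ := h_exists_ideal ((h_t_le_v _).trans (h_v_le_one (h_mul_div_le_one I)))
  refine ⟨J, hJ, ?_, ?_, ?_, ?_⟩
  · rintro rfl
    rw [h_itf_top] at hJ
    exact h hJ.symm
  · rw [IsTIdeal, hJ, h_t_t]
  · rw [← h_itf_mono, hJ]
    exact (h_le_mul_div I).trans (h_le_t _)
  · rw [h_strong_iff]
    intro x hx
    have hx2 := h_mem_div.1 hx
    rw [hJ] at hx2 ⊢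
    apply h_t_mul
    have h3 : ∀ b ∈ 1 / idealToFrac R I, x * b ∈ 1 / idealToFrac R I := by
      intro b hb
      refine h_mem_div.2 fun y hy => ?_
      have := hx2 _ (h_le_t _ (Submodule.mul_mem_mul hy hb))
      convert this using 1
      ring
    intro m hm
    induction hm using Submodule.mul_induction_on' with
    | mem_mul_mem a ha b hb =>
      have := Submodule.mul_mem_mul ha (h3 b hb)
      convert this using 1
      ring
    | add a _ b _ ia ib =>
      rw [mul_add]
      exact add_mem ia ib

theorem h_tinv_div {I : Ideal R} (ht : IsTIdeal R I) (h : IsTInvertible R I) :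
    IsDivisorial R I := by
  apply le_antisymm _ (h_le_v _)
  intro x hx
  have h1 : ∀ m ∈ idealToFrac R I * (1 / idealToFrac R I), x * m ∈ idealToFrac R I := by
    intro m hm
    induction hm using Submodule.mul_induction_on' with
    | mem_mul_mem a ha b hb =>
      obtain ⟨r, hr⟩ := h_mem_one.1 (h_mem_div.1 hx b hb)
      have : x * (a * b) = r • a := by
        rw [Algebra.smul_def, hr]
        ring
      rw [this]
      exact Submodule.smul_mem _ _ ha
    | add a _ b _ ia ib =>
      rw [mul_add]
      exact add_mem ia ib
  have h2 := h_t_mul h1 1 (by rw [show tClosure R _ = 1 from h]; exact Submodule.one_le.1 le_rfl)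
  rw [mul_one] at h2
  exact h_t_ideal_iff.1 ht h2

theorem h_strong_not_tinv {I : Ideal R} (hI : I ≠ ⊤) (ht : IsTIdeal R I) (hs : IsStrong R I) :
    ¬ IsTInvertible R I := by
  intro h
  have h1 : idealToFrac R I * (1 / idealToFrac R I) ≤ idealToFrac R I := by
    rw [Submodule.mul_le]
    intro x hx y hy
    rw [mul_comm]
    exact h_strong_iff.1 hs y hy x hx
  have h2 := (h_t_mono h1).trans (h_t_ideal_iff.1 ht)
  rw [show tClosure R _ = 1 from h, ← h_itf_top, h_itf_mono] at h2
  exact hI (top_le_iff.1 h2)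

/-- The ideal `(R : R[b])`. -/
def hCond (b : FractionRing R) : Ideal R where
  carrier := {r | ∀ n : ℕ, algebraMap R (FractionRing R) r * b ^ n ∈
    (1 : Submodule R (FractionRing R))}
  add_mem' := by
    intro x y hx hy n
    rw [map_add, add_mul]
    exact add_mem (hx n) (hy n)
  zero_mem' := by
    intro n
    simp
  smul_mem' := by
    intro c x hx n
    rw [smul_eq_mul, map_mul, mul_assoc]
    exact h_one_mul (h_alg_one c) (hx n)

theorem h_mem_cond {b : FractionRing R} {r : R} : r ∈ hCond b ↔
    ∀ n : ℕ, algebraMap R (FractionRing R) r * b ^ n ∈ (1 : Submodule R (FractionRing R)) :=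
  Iff.rfl

theorem h_mem_cond' {b x : FractionRing R} : x ∈ idealToFrac R (hCond b) ↔
    ∀ n : ℕ, x * b ^ n ∈ (1 : Submodule R (FractionRing R)) := by
  constructor
  · intro hx
    obtain ⟨r, hr, rfl⟩ := h_mem_itf.1 hx
    exact hr
  · intro h
    have h0 := h 0
    rw [pow_zero, mul_one] at h0
    obtain ⟨r, rfl⟩ := h_mem_one.1 h0
    exact h_alg_mem.2 h

theorem h_cond_mul {b x : FractionRing R} (hx : x ∈ idealToFrac R (hCond b)) (n : ℕ) :
    x * b ^ n ∈ idealToFrac R (hCond b) := by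
  rw [h_mem_cond'] at hx ⊢
  intro m
  rw [mul_assoc, ← pow_add]
  exact hx _

theorem h_cond_strong (b : FractionRing R) : IsStrong R (hCond b) := by
  rw [h_strong_iff]
  intro x hx y hy
  rw [h_mem_cond']
  intro n
  rw [mul_assoc]
  exact h_mem_div.1 hx _ (h_cond_mul hy n)

theorem h_cond_div (b : FractionRing R) : IsDivisorial R (hCond b) := by
  apply le_antisymm _ (h_le_v _)
  intro x hx
  rw [h_mem_cond']
  intro n
  refine h_mem_div.1 hx _ (h_mem_div.2 fun y hy => ?_)
  rw [mul_comm]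
  exact h_mem_cond'.1 hy n

theorem h_cond_prime {M : Ideal R} (hM : M.IsPrime) {b : FractionRing R}
    (hb : b ∈ 1 / idealToFrac R M) {a : FractionRing R} (ha : a ∈ idealToFrac R M)
    (hab : b * a ∉ idealToFrac R M) : (hCond b).IsPrime := by
  have hPM : hCond b ≤ M := by
    intro r hr
    by_contra hrM
    obtain ⟨s, hs⟩ := h_mem_one.1 (h_mem_div.1 hb a ha)
    obtain ⟨t, ht⟩ := h_mem_one.1 (h_mem_cond.1 hr 1)
    rw [pow_one] at ht
    obtain ⟨a', ha', rfl⟩ := h_mem_itf.1 ha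
    have h1 : r * s = t * a' := by
      apply IsFractionRing.injective R (FractionRing R)
      rw [map_mul, map_mul, hs, ht]
      ring
    have h2 : r * s ∈ M := by
      rw [h1]
      exact M.mul_mem_left _ ha'
    rcases hM.mem_or_mem h2 with h | h
    · exact hrM h
    · apply hab
      rw [← hs]
      exact h_alg_mem.2 h
  have key : ∀ r : R, r ∉ hCond b → ∃ n : ℕ, ∃ s : R, s ∉ M ∧
      algebraMap R (FractionRing R) s = algebraMap R (FractionRing R) r * b ^ n := by
    intro r hr
    by_contra! hcon
    apply hr
    rw [h_mem_cond]
    intro n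
    induction n with
    | zero => simpa using h_alg_one r
    | succ n ih =>
      obtain ⟨s, hs⟩ := h_mem_one.1 ih
      have hsM : s ∈ M := by
        by_contra hsM
        exact hcon n s hsM hs
      have := h_mem_div.1 hb _ (h_alg_mem.2 hsM)
      rw [hs] at this
      convert this using 1
      ring
  refine ⟨fun h => hM.ne_top (top_le_iff.1 (h ▸ hPM)), ?_⟩
  intro x y hxy
  by_contra! hcon
  obtain ⟨n, s, hs, hs'⟩ := key x hcon.1
  obtain ⟨m, t, ht, ht'⟩ := key y hcon.2
  have h1 := h_cond_mul (h_alg_mem.2 hxy) (n + m)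
  have h2 : algebraMap R (FractionRing R) (x * y) * b ^ (n + m) =
      algebraMap R (FractionRing R) (s * t) := by
    rw [map_mul, map_mul, hs', ht']
    ring
  rw [h2, h_alg_mem] at h1
  rcases hM.mem_or_mem (hPM h1) with h | h
  · exact hs h
  · exact ht h

theorem h_strong_le_cond {I : Ideal R} (hI : IsStrong R I) {b : FractionRing R}
    (hb : b ∈ 1 / idealToFrac R I) : I ≤ hCond b := by
  intro r hr
  have : ∀ n : ℕ, algebraMap R (FractionRing R) r * b ^ n ∈ idealToFrac R I := by
    intro n
    induction n with
    | zero => simpa using h_alg_mem.2 hr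
    | succ n ih =>
      have := h_strong_iff.1 hI b hb _ ih
      convert this using 1
      ring
  exact fun n => h_itf_le_one I (this n)

end Helpers

/-- For an integral domain `R` the following are equivalent:
(1) `R` has no nonzero proper strong `t`-ideals;
(2) `R` has no nonzero strong prime `t`-ideals;
(3) `R` has no strongly divisorial prime ideals and each maximal `t`-ideal is
`t`-invertible;
(4) `R` has no strongly divisorial prime ideals and each maximal `t`-ideal is
divisorial;
(5) `R` is completely integrally closed and each maximal `t`-ideal is divisorial;
(6) each nonzero `t`-ideal of `R` is `t`-invertible. -/
theorem tfae_no_strong_t_ideals {R : Type*} [CommRing R] [IsDomain R] :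
    List.TFAE [
      ¬ ∃ I : Ideal R, I ≠ ⊥ ∧ I ≠ ⊤ ∧ IsStrong R I ∧ IsTIdeal R I,
      ¬ ∃ P : Ideal R, P.IsPrime ∧ P ≠ ⊥ ∧ IsStrong R P ∧ IsTIdeal R P,
      (¬ ∃ P : Ideal R, P.IsPrime ∧ P ≠ ⊥ ∧ IsStrong R P ∧ IsDivisorial R P) ∧
        ∀ I : Ideal R, IsMaximalTIdeal R I → IsTInvertible R I,
      (¬ ∃ P : Ideal R, P.IsPrime ∧ P ≠ ⊥ ∧ IsStrong R P ∧ IsDivisorial R P) ∧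
        ∀ I : Ideal R, I ≠ ⊥ → IsMaximalTIdeal R I → IsDivisorial R I,
      CompletelyIntegrallyClosed R ∧
        ∀ I : Ideal R, I ≠ ⊥ → IsMaximalTIdeal R I → IsDivisorial R I,
      ∀ I : Ideal R, I ≠ ⊥ → IsTIdeal R I → IsTInvertible R I] := by
  tfae_have 1 → 2 := by
    rintro h ⟨P, hP, h0, hs, ht⟩
    exact h ⟨P, h0, hP.ne_top, hs, ht⟩
  tfae_have 2 → 3 := by
    intro h
    refine ⟨?_, ?_⟩
    · rintro ⟨P, hP, h0, hs, hd⟩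
      exact h ⟨P, hP, h0, hs, h_div_isT hd⟩
    · intro M hM
      by_contra hcon
      obtain ⟨J, -, hJ, ht, hle, hs⟩ := h_not_tinv hcon
      obtain rfl := hM.2.2 J hJ ht hle
      exact h ⟨J, h_max_prime hM, h_max_ne_bot hM, hs, ht⟩
  tfae_have 3 → 4 := by
    rintro ⟨h1, h2⟩
    exact ⟨h1, fun I _ hI => h_tinv_div hI.2.1 (h2 I hI)⟩
  tfae_have 4 → 1 := by
    rintro ⟨h1, h2⟩ ⟨I, h0, hI, hs, ht⟩
    obtain ⟨M, hIM, hM⟩ := h_exists_max hI ht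
    have hM0 := h_max_ne_bot hM
    have hMs : ¬ IsStrong R M := fun hMs => h1 ⟨M, h_max_prime hM, hM0, hMs, h2 M hM0 hM⟩
    rw [h_strong_iff] at hMs
    push Not at hMs
    obtain ⟨b, hb, a, ha, hab⟩ := hMs
    have hbI : b ∈ 1 / idealToFrac R I :=
      h_mem_div.2 fun y hy => h_mem_div.1 hb y (h_itf_mono.2 hIM hy)
    refine h1 ⟨hCond b, h_cond_prime (h_max_prime hM) hb ha hab, ?_, h_cond_strong b,
      h_cond_div b⟩
    intro hbot
    exact h0 (le_bot_iff.1 (hbot ▸ h_strong_le_cond hs hbI))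
  tfae_have 1 → 6 := by
    intro h I h0 ht
    by_contra hcon
    obtain ⟨J, -, hJ, ht', hle, hs⟩ := h_not_tinv hcon
    exact h ⟨J, fun hJ0 => h0 (le_bot_iff.1 (hJ0 ▸ hle)), hJ, hs, ht'⟩
  tfae_have 6 → 1 := by
    rintro h ⟨I, h0, hI, hs, ht⟩
    exact h_strong_not_tinv hI ht hs (h I h0 ht)
  tfae_have 4 → 5 := by
    intro h4
    refine ⟨?_, h4.2⟩
    have h1 := tfae_4_to_1 h4
    rintro x ⟨d, hd, hx⟩
    by_contra hxR
    refine h1 ⟨hCond x, ?_, ?_, h_cond_strong x, h_div_isT (h_cond_div x)⟩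
    · intro hbot
      have : d ∈ hCond x := fun n => h_mem_one.2 (hx n)
      rw [hbot] at this
      exact hd (by simpa using this)
    · intro htop
      have h := (Ideal.eq_top_iff_one _).1 htop
      have := h_mem_cond.1 h 1
      rw [map_one, one_mul, pow_one] at this
      exact hxR (h_mem_one.1 this)
  tfae_have 5 → 4 := by
    rintro ⟨hc, h2⟩
    refine ⟨?_, h2⟩
    rintro ⟨P, hP, h0, hs, hd⟩
    obtain ⟨d, hdP, hd0⟩ := Submodule.exists_mem_ne_zero_of_ne_bot h0
    have h1 : (1 : FractionRing R) ∈ 1 / (1 / idealToFrac R P) := by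
      refine h_mem_div.2 fun x hx => ?_
      rw [one_mul]
      refine h_mem_one.2 (hc x ⟨d, hd0, fun n => ?_⟩)
      exact h_mem_one.1 (h_mem_cond.1 (h_strong_le_cond hs hx hdP) n)
    rw [show 1 / (1 / idealToFrac R P) = _ from hd, ← map_one (algebraMap R (FractionRing R)),
      h_alg_mem] at h1
    exact hP.ne_top ((Ideal.eq_top_iff_one _).2 h1)
  tfae_finish
end

section
/- Let R be an integral domain in which every nonzero ideal is divisorial. Then the following conditions are equivalent: (1) R has no strongly divisorial prime ideals; (2) R is completely integrally closed; (3) R is a Dedekind domain. -/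
/-! Basic notions: for an integral domain `R` with fraction field `K`, an ideal `I`
is viewed as the submodule `idealToFrac R I` of `K`; `1 / M` is the Mathlib
submodule quotient `(R : M) = {x ∈ K | x M ⊆ R}` and `M / N = {x ∈ K | x N ⊆ M}`. -/

variable (R : Type*) [CommRing R] [IsDomain R]

open scoped nonZeroDivisors

theorem aux_mem_idealToFrac {R : Type*} [CommRing R] [IsDomain R] {I : Ideal R}
    {x : FractionRing R} :
    x ∈ idealToFrac R I ↔ ∃ r ∈ I, algebraMap R (FractionRing R) r = x := by
  simp [idealToFrac]

theorem aux_mem_one {R : Type*} [CommRing R] [IsDomain R] {x : FractionRing R} :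
    x ∈ (1 : Submodule R (FractionRing R)) ↔ ∃ r : R, algebraMap R (FractionRing R) r = x := by
  simp [Submodule.mem_one]

theorem aux_mem_dual {R : Type*} [CommRing R] [IsDomain R] {I : Ideal R} {x : FractionRing R} :
    x ∈ 1 / idealToFrac R I ↔
      ∀ r ∈ I, ∃ s : R, algebraMap R (FractionRing R) s = x * algebraMap R (FractionRing R) r := by
  rw [Submodule.mem_div_iff_forall_mul_mem]
  constructor
  · intro h r hr
    exact aux_mem_one.1 (h _ (aux_mem_idealToFrac.2 ⟨r, hr, rfl⟩))
  · intro h y hy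
    obtain ⟨r, hr, rfl⟩ := aux_mem_idealToFrac.1 hy
    exact aux_mem_one.2 (h r hr)

theorem aux_mem_endo {R : Type*} [CommRing R] [IsDomain R] {I : Ideal R} {x : FractionRing R} :
    x ∈ idealToFrac R I / idealToFrac R I ↔
      ∀ r ∈ I, ∃ s ∈ I,
        algebraMap R (FractionRing R) s = x * algebraMap R (FractionRing R) r := by
  rw [Submodule.mem_div_iff_forall_mul_mem]
  constructor
  · intro h r hr
    exact aux_mem_idealToFrac.1 (h _ (aux_mem_idealToFrac.2 ⟨r, hr, rfl⟩))
  · intro h y hy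
    obtain ⟨r, hr, rfl⟩ := aux_mem_idealToFrac.1 hy
    exact aux_mem_idealToFrac.2 (h r hr)

theorem aux_isStrong_iff {R : Type*} [CommRing R] [IsDomain R] {I : Ideal R} :
    IsStrong R I ↔ ∀ x ∈ 1 / idealToFrac R I, x ∈ idealToFrac R I / idealToFrac R I := by
  constructor
  · intro h x hx
    rw [← h]; exact hx
  · intro h
    refine le_antisymm h ?_
    intro x hx
    rw [aux_mem_endo] at hx
    rw [aux_mem_dual]
    intro r hr
    obtain ⟨s, _, hs⟩ := hx r hr
    exact ⟨s, hs⟩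

/-- The ideal of `r` such that `r x ^ n ∈ R` for all `n`. -/
def auxIdeal (R : Type*) [CommRing R] [IsDomain R] (x : FractionRing R) : Ideal R where
  carrier := {r | ∀ n : ℕ, ∃ s : R,
    algebraMap R (FractionRing R) s = algebraMap R (FractionRing R) r * x ^ n}
  zero_mem' := fun n => ⟨0, by simp⟩
  add_mem' := by
    intro a b ha hb n
    obtain ⟨s, hs⟩ := ha n
    obtain ⟨t, ht⟩ := hb n
    exact ⟨s + t, by rw [map_add, map_add, hs, ht]; ring⟩
  smul_mem' := by
    intro c a ha n
    obtain ⟨s, hs⟩ := ha n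
    exact ⟨c * s, by rw [smul_eq_mul, map_mul, map_mul, hs]; ring⟩

theorem aux_mem_auxIdeal {R : Type*} [CommRing R] [IsDomain R] {x : FractionRing R} {r : R} :
    r ∈ auxIdeal R x ↔ ∀ n : ℕ, ∃ s : R,
    algebraMap R (FractionRing R) s = algebraMap R (FractionRing R) r * x ^ n := Iff.rfl

theorem aux_shift {R : Type*} [CommRing R] [IsDomain R] {x : FractionRing R} {r s : R}
    (k : ℕ) (hr : r ∈ auxIdeal R x)
    (hs : algebraMap R (FractionRing R) s = algebraMap R (FractionRing R) r * x ^ k) :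
    s ∈ auxIdeal R x := by
  intro n
  obtain ⟨t, ht⟩ := hr (k + n)
  exact ⟨t, by rw [ht, hs]; ring⟩

theorem aux_strong {R : Type*} [CommRing R] [IsDomain R] (x : FractionRing R) :
    IsStrong R (auxIdeal R x) := by
  rw [aux_isStrong_iff]
  intro z hz
  rw [aux_mem_dual] at hz
  rw [aux_mem_endo]
  intro y hy
  obtain ⟨s, hs⟩ := hz y hy
  refine ⟨s, ?_, hs⟩
  intro n
  obtain ⟨t, ht⟩ := hy n
  obtain ⟨w, hw⟩ := hz t (aux_shift n hy ht)
  exact ⟨w, by rw [hw, hs, ht]; ring⟩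

theorem aux_last {R : Type*} [CommRing R] [IsDomain R] {M : Ideal R}
    {x : FractionRing R}
    (hx : ∀ r ∈ M, ∃ s : R, algebraMap R (FractionRing R) s = x * algebraMap R (FractionRing R) r)
    {a : R} (ha : a ∉ auxIdeal R x) :
    ∃ (i : ℕ) (s : R), s ∉ M ∧
      algebraMap R (FractionRing R) s = algebraMap R (FractionRing R) a * x ^ i := by
  by_contra hcon
  push Not at hcon
  apply ha
  intro n
  induction n with
  | zero => exact ⟨a, by simp⟩
  | succ n ih =>
    obtain ⟨s, hs⟩ := ih
    have hsM : s ∈ M := by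
      by_contra h
      exact hcon n s h hs
    obtain ⟨t, ht⟩ := hx s hsM
    exact ⟨t, by rw [ht, hs]; ring⟩

theorem aux_prime {R : Type*} [CommRing R] [IsDomain R] {M : Ideal R} (hM : M.IsPrime)
    {x : FractionRing R}
    (hx : ∀ r ∈ M, ∃ s : R, algebraMap R (FractionRing R) s = x * algebraMap R (FractionRing R) r)
    {p r : R} (hp : p ∈ M) (hr : r ∉ M)
    (hpr : algebraMap R (FractionRing R) r = x * algebraMap R (FractionRing R) p) :
    (auxIdeal R x).IsPrime := by
  have hinj := IsFractionRing.injective R (FractionRing R)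
  have key : ∀ c : R, c ∉ M → ∀ t : R,
      algebraMap R (FractionRing R) t ≠ algebraMap R (FractionRing R) c * x := by
    intro c hc t ht
    have : r * c = p * t := by
      apply hinj
      rw [map_mul, map_mul, ht, hpr]; ring
    rcases hM.mem_or_mem (this ▸ M.mul_mem_right t hp : r * c ∈ M) with h | h
    · exact hr h
    · exact hc h
  refine ⟨?_, ?_⟩
  · intro h
    have h1 : (1 : R) ∈ auxIdeal R x := h ▸ Submodule.mem_top
    obtain ⟨s, hs⟩ := h1 1
    exact key 1 (fun h => hM.ne_top ((Ideal.eq_top_iff_one _).2 h)) s (by rw [hs]; ring)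
  · intro a b hab
    by_contra hcon
    push Not at hcon
    obtain ⟨i, s, hsM, hs⟩ := aux_last hx hcon.1
    obtain ⟨j, t, htM, ht⟩ := aux_last hx hcon.2
    obtain ⟨w, hw⟩ := hab (i + j + 1)
    refine key (s * t) (fun h => ?_) w ?_
    · rcases hM.mem_or_mem h with h | h
      · exact hsM h
      · exact htM h
    · rw [hw, map_mul, map_mul, hs, ht]; ring

theorem aux_one_two {R : Type*} [CommRing R] [IsDomain R]
    (hdiv : ∀ I : Ideal R, I ≠ ⊥ → IsDivisorial R I)
    (h : ¬ ∃ P : Ideal R, P.IsPrime ∧ P ≠ ⊥ ∧ IsStrong R P ∧ IsDivisorial R P) :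
    CompletelyIntegrallyClosed R := by
  rintro u ⟨d, hd, hdu⟩
  have hdI : d ∈ auxIdeal R u := fun n => hdu n
  by_cases htop : auxIdeal R u = ⊤
  · have h1 : (1 : R) ∈ auxIdeal R u := htop ▸ Submodule.mem_top
    obtain ⟨s, hs⟩ := h1 1
    exact ⟨s, by rw [hs]; simp⟩
  exfalso
  obtain ⟨M, hM, hIM⟩ := Ideal.exists_le_maximal _ htop
  have hMbot : M ≠ ⊥ := by
    rintro rfl
    exact hd (by simpa using hIM hdI)
  have hns : ¬ IsStrong R M := fun hs => h ⟨M, hM.isPrime, hMbot, hs, hdiv M hMbot⟩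
  rw [aux_isStrong_iff] at hns
  push Not at hns
  obtain ⟨x, hx, hx'⟩ := hns
  rw [aux_mem_dual] at hx
  rw [aux_mem_endo] at hx'
  push Not at hx'
  obtain ⟨p, hp, hp'⟩ := hx'
  obtain ⟨r, hr⟩ := hx p hp
  have hrM : r ∉ M := fun h => hp' r h hr
  have hprime := aux_prime hM.isPrime hx hp hrM hr
  have step : ∀ y ∈ auxIdeal R u, ∃ s ∈ auxIdeal R u,
      algebraMap R (FractionRing R) s = x * algebraMap R (FractionRing R) y := by
    intro y hy
    obtain ⟨s, hs⟩ := hx y (hIM hy)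
    refine ⟨s, fun n => ?_, hs⟩
    obtain ⟨t, ht⟩ := hy n
    obtain ⟨w, hw⟩ := hx t (hIM (aux_shift n hy ht))
    exact ⟨w, by rw [hw, ht, hs]; ring⟩
  have hdx : d ∈ auxIdeal R x := by
    intro n
    have : ∃ s ∈ auxIdeal R u,
        algebraMap R (FractionRing R) s = algebraMap R (FractionRing R) d * x ^ n := by
      induction n with
      | zero => exact ⟨d, hdI, by simp⟩
      | succ n ih =>
        obtain ⟨s, hsI, hs⟩ := ih
        obtain ⟨t, htI, ht⟩ := step s hsI
        exact ⟨t, htI, by rw [ht, hs]; ring⟩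
    obtain ⟨s, _, hs⟩ := this
    exact ⟨s, hs⟩
  have hbot : auxIdeal R x ≠ ⊥ := by
    intro hb
    rw [hb] at hdx
    exact hd (by simpa using hdx)
  exact h ⟨_, hprime, hbot, aux_strong x, hdiv _ hbot⟩

theorem aux_two_three {R : Type*} [CommRing R] [IsDomain R]
    (hdiv : ∀ I : Ideal R, I ≠ ⊥ → IsDivisorial R I)
    (h : CompletelyIntegrallyClosed R) : IsDedekindDomain R := by
  rw [isDedekindDomain_iff_mul_inv_cancel (A := R) (K := FractionRing R)]
  intro I hI
  have hI0 : I ≠ 0 := hI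
  have hle : I * I⁻¹ ≤ 1 := FractionalIdeal.mul_one_div_le_one
  obtain ⟨J, hJ⟩ := FractionalIdeal.le_one_iff_exists_coeIdeal.1 hle
  obtain ⟨b, hbI, hb0⟩ : ∃ b ∈ I, b ≠ 0 := by
    by_contra hcon
    push Not at hcon
    exact hI0 (FractionalIdeal.eq_zero_iff.2 hcon)
  have hinv0 : I⁻¹ ≠ 0 := by
    obtain ⟨a, J', ha, hJ'⟩ := FractionalIdeal.exists_eq_spanSingleton_mul I
    intro h0
    have : algebraMap R (FractionRing R) a ∈ I⁻¹ := by
      rw [FractionalIdeal.mem_inv_iff hI0]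
      intro y hy
      rw [hJ', FractionalIdeal.mem_singleton_mul] at hy
      obtain ⟨y', hy', rfl⟩ := hy
      rw [← mul_assoc, mul_inv_cancel₀, one_mul]
      · exact FractionalIdeal.coeIdeal_le_one hy'
      · simpa using ha
    rw [h0, FractionalIdeal.mem_zero_iff] at this
    exact ha (by simpa using this)
  obtain ⟨a, haI, ha0⟩ : ∃ a ∈ I⁻¹, a ≠ 0 := by
    by_contra hcon
    push Not at hcon
    exact hinv0 (FractionalIdeal.eq_zero_iff.2 hcon)
  have hab : b * a ∈ I * I⁻¹ := FractionalIdeal.mul_mem_mul hbI haI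
  have hJmem : ∀ y, y ∈ I * I⁻¹ ↔ y ∈ idealToFrac R J := by
    intro y
    rw [← hJ, FractionalIdeal.mem_coeIdeal, aux_mem_idealToFrac]
  have hJ0 : J ≠ ⊥ := by
    rintro rfl
    rw [← hJ] at hab
    simp [ha0, hb0] at hab
  have hdual : ∀ x ∈ 1 / idealToFrac R J, ∃ s : R, algebraMap R (FractionRing R) s = x := by
    intro x hx
    have hx1 : ∀ y ∈ I⁻¹, x * y ∈ I⁻¹ := by
      intro y hy
      rw [FractionalIdeal.mem_inv_iff hI0]
      intro z hz
      have h1 := (Submodule.mem_div_iff_forall_mul_mem.1 hx) (z * y)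
        ((hJmem _).1 (FractionalIdeal.mul_mem_mul hz hy))
      rw [aux_mem_one] at h1
      rw [FractionalIdeal.mem_one_iff]
      obtain ⟨s, hs⟩ := h1
      exact ⟨s, by rw [hs]; ring⟩
    have hxn : ∀ n : ℕ, a * x ^ n ∈ I⁻¹ := by
      intro n
      induction n with
      | zero => simpa using haI
      | succ n ih =>
        have := hx1 _ ih
        rwa [show x * (a * x ^ n) = a * x ^ (n + 1) by ring] at this
    obtain ⟨d, hd⟩ := (FractionalIdeal.mem_one_iff _).1 (hle hab)
    refine h x ⟨d, ?_, ?_⟩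
    · rintro rfl
      rw [map_zero] at hd
      exact mul_ne_zero hb0 ha0 hd.symm
    · intro n
      obtain ⟨s, hs⟩ := (FractionalIdeal.mem_one_iff _).1
        (hle (FractionalIdeal.mul_mem_mul hbI (hxn n)))
      exact ⟨s, by rw [hs, hd]; ring⟩
  have hone : (1 : FractionRing R) ∈ I * I⁻¹ := by
    rw [hJmem, ← (hdiv J hJ0 : 1 / (1 / idealToFrac R J) = idealToFrac R J),
      Submodule.mem_div_iff_forall_mul_mem]
    intro y hy
    rw [one_mul, aux_mem_one]
    exact hdual y hy
  exact le_antisymm hle (FractionalIdeal.one_le.2 hone)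

theorem aux_three_one {R : Type*} [CommRing R] [IsDomain R]
    (h : IsDedekindDomain R) :
    ¬ ∃ P : Ideal R, P.IsPrime ∧ P ≠ ⊥ ∧ IsStrong R P ∧ IsDivisorial R P := by
  rintro ⟨P, hP, hP0, hs, -⟩
  rw [aux_isStrong_iff] at hs
  have hP0' : (P : FractionalIdeal R⁰ (FractionRing R)) ≠ 0 := by
    simpa using hP0
  have hmul := mul_inv_cancel₀ hP0'
  have hle : (P : FractionalIdeal R⁰ (FractionRing R)) *
      (P : FractionalIdeal R⁰ (FractionRing R))⁻¹ ≤ P := by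
    rw [FractionalIdeal.mul_le]
    intro i hi j hj
    rw [FractionalIdeal.mem_coeIdeal] at hi
    obtain ⟨r, hr, rfl⟩ := hi
    have hj' : j ∈ 1 / idealToFrac R P := by
      rw [aux_mem_dual]
      intro r hr
      exact (FractionalIdeal.mem_one_iff _).1 ((FractionalIdeal.mem_inv_iff hP0').1 hj _
        (FractionalIdeal.mem_coeIdeal_of_mem _ hr))
    obtain ⟨s, hsP, hs'⟩ := aux_mem_endo.1 (hs j hj') r hr
    rw [FractionalIdeal.mem_coeIdeal]
    exact ⟨s, hsP, by rw [hs']; ring⟩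
  rw [hmul] at hle
  have h1 := FractionalIdeal.one_le.1 hle
  rw [FractionalIdeal.mem_coeIdeal] at h1
  obtain ⟨s, hsP, hs1⟩ := h1
  have : s = 1 := IsFractionRing.injective R (FractionRing R) (by rw [hs1, map_one])
  exact hP.ne_top ((Ideal.eq_top_iff_one _).2 (this ▸ hsP))

/-- Let `R` be a domain in which every nonzero ideal is divisorial. The following are
equivalent: (1) `R` has no strongly divisorial prime ideals; (2) `R` is completely
integrally closed; (3) `R` is a Dedekind domain. -/
theorem tfae_divisorial_domain {R : Type*} [CommRing R] [IsDomain R]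
    (hdiv : ∀ I : Ideal R, I ≠ ⊥ → IsDivisorial R I) :
    List.TFAE [
      ¬ ∃ P : Ideal R, P.IsPrime ∧ P ≠ ⊥ ∧ IsStrong R P ∧ IsDivisorial R P,
      CompletelyIntegrallyClosed R,
      IsDedekindDomain R] := by
  tfae_have 1 → 2 := aux_one_two hdiv
  tfae_have 2 → 3 := aux_two_three hdiv
  tfae_have 3 → 1 := aux_three_one
  tfae_finish
end
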